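/- arXiv:1508.05408 — 2 statements merged into one kernel-verified Lean document; each statement's English description precedes it below -/
import Mathlib

section
/- There exists a constant C > 0, depending only on the data (u_T, m₀, L, T, σ, r, ε), such that every smooth solution (u,m) of the MFG system satisfies |f(t)| ≤ C for all t ∈ [0,T], where f(t) = 2/(2 + ε η(t)) + (ε/(2 + ε η(t))) ∫₀^L u_x(t,x) m(t,x) dx (i.e., the quantity a(η(t)) + c(η(t)) p̄(t) is uniformly bounded). -/
open Set MeasureTheory intervalIntegral Function

noncomputable section

/-- Spatial derivative `u_x`. -/
def pdx (u : ℝ → ℝ → ℝ) (t x : ℝ) : ℝ := deriv (u t) x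

/-- Second spatial derivative `u_xx`. -/
def pdxx (u : ℝ → ℝ → ℝ) (t x : ℝ) : ℝ := deriv (deriv (u t)) x

/-- Time derivative `u_t`. -/
def pdt (u : ℝ → ℝ → ℝ) (t x : ℝ) : ℝ := deriv (fun s => u s x) t

/-- `η(t) = ∫₀^L m(t,x) dx`. -/
def mfgEta (L : ℝ) (m : ℝ → ℝ → ℝ) (t : ℝ) : ℝ := ∫ x in (0:ℝ)..L, m t x

/-- `f(t) = a(η(t)) + c(η(t)) p̄(t)`. -/
def mfgF (L ε : ℝ) (u m : ℝ → ℝ → ℝ) (t : ℝ) : ℝ :=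
  2 / (2 + ε * mfgEta L m t)
    + (ε / (2 + ε * mfgEta L m t)) * ∫ x in (0:ℝ)..L, pdx u t x * m t x

/-- `G(t,x) = (1/2)(f(t) − u_x(t,x))`. -/
def mfgG (L ε : ℝ) (u m : ℝ → ℝ → ℝ) (t x : ℝ) : ℝ :=
  (1/2) * (mfgF L ε u m t - pdx u t x)

/-- `H(t,x) = G(t,x)²`. -/
def mfgH (L ε : ℝ) (u m : ℝ → ℝ → ℝ) (t x : ℝ) : ℝ := (mfgG L ε u m t x)^2

/-- Standing assumptions on the data. -/
structure MFGData (T L σ r ε : ℝ) (uT m0 : ℝ → ℝ) : Prop where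
  hT : 0 < T
  hL : 0 < L
  hσ : 0 < σ
  hr : 0 < r
  hε : 0 ≤ ε
  uT_smooth : ContDiff ℝ 2 uT
  m0_smooth : ContDiff ℝ 2 m0
  uT_zero : uT 0 = 0
  uT_deriv_L : deriv uT L = 0
  uT_nonneg : ∀ x ∈ Icc (0:ℝ) L, 0 ≤ uT x
  uT_deriv_nonneg : ∀ x ∈ Icc (0:ℝ) L, 0 ≤ deriv uT x
  m0_zero : m0 0 = 0
  m0_L : m0 L = 0
  m0_deriv_L : deriv m0 L = 0
  m0_nonneg : ∀ x ∈ Icc (0:ℝ) L, 0 ≤ m0 x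
  m0_mass : (∫ x in (0:ℝ)..L, m0 x) = 1

/-- A smooth solution of the MFG system \eqref{main system}. -/
structure IsMFGSolution (T L σ r ε : ℝ) (uT m0 : ℝ → ℝ) (u m : ℝ → ℝ → ℝ) : Prop where
  u_smooth : ContDiff ℝ (⊤ : ℕ∞) (uncurry u)
  m_smooth : ContDiff ℝ (⊤ : ℕ∞) (uncurry m)
  hjb : ∀ t ∈ Ioo (0:ℝ) T, ∀ x ∈ Ioo (0:ℝ) L,
    pdt u t x + σ^2/2 * pdxx u t x - r * u t x + mfgH L ε u m t x = 0
  fp : ∀ t ∈ Ioo (0:ℝ) T, ∀ x ∈ Ioo (0:ℝ) L,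
    pdt m t x - σ^2/2 * pdxx m t x
      - deriv (fun y => mfgG L ε u m t y * m t y) x = 0
  m_init : ∀ x ∈ Icc (0:ℝ) L, m 0 x = m0 x
  u_term : ∀ x ∈ Icc (0:ℝ) L, u T x = uT x
  u_bdry : ∀ t ∈ Icc (0:ℝ) T, u t 0 = 0
  m_bdry : ∀ t ∈ Icc (0:ℝ) T, m t 0 = 0
  ux_bdry : ∀ t ∈ Icc (0:ℝ) T, pdx u t L = 0
  m_flux : ∀ t ∈ Icc (0:ℝ) T,
    σ^2/2 * pdx m t L + mfgG L ε u m t L * m t L = 0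

end

section Calculus

variable {g : ℝ → ℝ → ℝ}

theorem hasDerivAt_pdx (hg : ContDiff ℝ (⊤ : ℕ∞) (uncurry g)) (t x : ℝ) :
    HasDerivAt (g t) (pdx g t x) x := by
  have h : ContDiff ℝ (⊤ : ℕ∞) (g t) := hg.comp (contDiff_prodMk_right t)
  exact (h.differentiable (by simp) x).hasDerivAt

theorem hasDerivAt_pdt (hg : ContDiff ℝ (⊤ : ℕ∞) (uncurry g)) (t x : ℝ) :
    HasDerivAt (fun s => g s x) (pdt g t x) t := by
  have h : ContDiff ℝ (⊤ : ℕ∞) (fun s => g s x) := hg.comp (contDiff_prodMk_left x)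
  exact (h.differentiable (by simp) t).hasDerivAt

theorem pdx_eq_fderiv (hg : ContDiff ℝ (⊤ : ℕ∞) (uncurry g)) (t x : ℝ) :
    pdx g t x = fderiv ℝ (uncurry g) (t, x) (0, 1) := by
  have h := (hg.differentiable (by simp) (t, x)).hasFDerivAt
  have h2 : HasDerivAt (fun y : ℝ => (t, y)) ((0 : ℝ), (1 : ℝ)) x :=
    (hasDerivAt_const x t).prodMk (hasDerivAt_id x)
  exact (h.comp_hasDerivAt x h2).deriv

theorem pdt_eq_fderiv (hg : ContDiff ℝ (⊤ : ℕ∞) (uncurry g)) (t x : ℝ) :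
    pdt g t x = fderiv ℝ (uncurry g) (t, x) (1, 0) := by
  have h := (hg.differentiable (by simp) (t, x)).hasFDerivAt
  have h2 : HasDerivAt (fun s : ℝ => (s, x)) ((1 : ℝ), (0 : ℝ)) t :=
    (hasDerivAt_id t).prodMk (hasDerivAt_const t x)
  exact (h.comp_hasDerivAt t h2).deriv

theorem contDiff_pdx (hg : ContDiff ℝ (⊤ : ℕ∞) (uncurry g)) :
    ContDiff ℝ (⊤ : ℕ∞) (uncurry (pdx g)) := by
  have h : uncurry (pdx g) = fun z => fderiv ℝ (uncurry g) z (0, 1) := by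
    funext ⟨t, x⟩; exact pdx_eq_fderiv hg t x
  rw [h]
  exact (hg.fderiv_right (by simp)).clm_apply contDiff_const

theorem contDiff_pdt (hg : ContDiff ℝ (⊤ : ℕ∞) (uncurry g)) :
    ContDiff ℝ (⊤ : ℕ∞) (uncurry (pdt g)) := by
  have h : uncurry (pdt g) = fun z => fderiv ℝ (uncurry g) z (1, 0) := by
    funext ⟨t, x⟩; exact pdt_eq_fderiv hg t x
  rw [h]
  exact (hg.fderiv_right (by simp)).clm_apply contDiff_const

theorem contDiff_pdxx (hg : ContDiff ℝ (⊤ : ℕ∞) (uncurry g)) :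
    ContDiff ℝ (⊤ : ℕ∞) (uncurry (pdxx g)) :=
  contDiff_pdx (contDiff_pdx hg)

theorem hasDerivAt_pdxx (hg : ContDiff ℝ (⊤ : ℕ∞) (uncurry g)) (t x : ℝ) :
    HasDerivAt (pdx g t) (pdxx g t x) x :=
  hasDerivAt_pdx (contDiff_pdx hg) t x

theorem pdt_pdx_comm (hg : ContDiff ℝ (⊤ : ℕ∞) (uncurry g)) (t x : ℝ) :
    pdt (pdx g) t x = pdx (pdt g) t x := by
  rw [pdt_eq_fderiv (contDiff_pdx hg), pdx_eq_fderiv (contDiff_pdt hg)]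
  have hx : uncurry (pdx g) = fun z => fderiv ℝ (uncurry g) z (0, 1) := by
    funext ⟨t, x⟩; exact pdx_eq_fderiv hg t x
  have ht : uncurry (pdt g) = fun z => fderiv ℝ (uncurry g) z (1, 0) := by
    funext ⟨t, x⟩; exact pdt_eq_fderiv hg t x
  have hd : DifferentiableAt ℝ (fderiv ℝ (uncurry g)) (t, x) :=
    ((hg.fderiv_right (m := (⊤ : ℕ∞)) (by simp)).differentiable (by simp)) (t, x)
  have hs : IsSymmSndFDerivAt ℝ (uncurry g) (t, x) :=
    hg.contDiffAt.isSymmSndFDerivAt (by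
      simp only [minSmoothness_of_isRCLikeNormedField]; exact WithTop.coe_le_coe.2 (le_top (a := (2 : ℕ∞))))
  rw [hx, ht, fderiv_clm_apply hd (by fun_prop), fderiv_clm_apply hd (by fun_prop)]
  simpa using hs (1, 0) (0, 1)

theorem continuous_slice (hg : Continuous (uncurry g)) (t : ℝ) : Continuous (g t) :=
  hg.comp (Continuous.prodMk_right t)

theorem hasDerivAt_integral_pdt (hg : ContDiff ℝ (⊤ : ℕ∞) (uncurry g)) (a b t : ℝ) :
    HasDerivAt (fun s => ∫ x in a..b, g s x) (∫ x in a..b, pdt g t x) t := by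
  have hc : Continuous (uncurry g) := hg.continuous
  have hc' : Continuous (uncurry (pdt g)) := (contDiff_pdt hg).continuous
  obtain ⟨C, hC⟩ := (isCompact_Icc.prod isCompact_uIcc :
    IsCompact (Icc (t - 1) (t + 1) ×ˢ uIcc a b)).exists_bound_of_continuousOn hc'.continuousOn
  refine (hasDerivAt_integral_of_dominated_loc_of_deriv_le (bound := fun _ => C)
    (F' := pdt g) (s := Icc (t - 1) (t + 1)) (Icc_mem_nhds (by linarith) (by linarith))
    (Filter.Eventually.of_forall fun s => (continuous_slice hc s).aestronglyMeasurable)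
    ((continuous_slice hc t).intervalIntegrable _ _)
    (continuous_slice hc' t).aestronglyMeasurable ?_ (by simp) ?_).2
  · exact Filter.Eventually.of_forall fun x hx s hs =>
      hC (s, x) ⟨hs, uIoc_subset_uIcc hx⟩
  · exact Filter.Eventually.of_forall fun x _ s _ => hasDerivAt_pdt hg s x

theorem continuous_integral_slice (hg : Continuous (uncurry g)) (a b : ℝ) :
    Continuous fun s => ∫ x in a..b, g s x :=
  continuous_parametric_intervalIntegral_of_continuous' hg a b

end Calculus

section Extrema

variable {h : ℝ → ℝ} {a b d x : ℝ}

theorem HasDerivAt.nonneg_of_le_right (hd : HasDerivAt h d x) (hb : x < b)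
    (hmin : ∀ y ∈ Icc x b, h x ≤ h y) : 0 ≤ d := by
  have h1 := (hasDerivAt_iff_tendsto_slope_left_right.1 hd).2
  refine ge_of_tendsto h1 ?_
  filter_upwards [Ioo_mem_nhdsGT hb] with y hy
  rw [slope_def_field]
  exact div_nonneg (sub_nonneg.2 (hmin y ⟨hy.1.le, hy.2.le⟩)) (sub_nonneg.2 hy.1.le)

theorem HasDerivAt.nonpos_of_le_left (hd : HasDerivAt h d x) (ha : a < x)
    (hmin : ∀ y ∈ Icc a x, h x ≤ h y) : d ≤ 0 := by
  have h1 := (hasDerivAt_iff_tendsto_slope_left_right.1 hd).1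
  refine le_of_tendsto h1 ?_
  filter_upwards [Ioo_mem_nhdsLT ha] with y hy
  rw [slope_def_field]
  exact div_nonpos_of_nonneg_of_nonpos (sub_nonneg.2 (hmin y ⟨hy.1.le, hy.2.le⟩))
    (sub_nonpos.2 hy.2.le)

theorem second_deriv_nonneg_of_le_left {h1 : ℝ → ℝ} (hh : ∀ y, HasDerivAt h (h1 y) y)
    (h1x : h1 x = 0) (hd : HasDerivAt h1 d x) (ha : a < x)
    (hmin : ∀ y ∈ Icc a x, h x ≤ h y) : 0 ≤ d := by
  by_contra! hneg
  have h2 := (hasDerivAt_iff_tendsto_slope_left_right.1 hd).1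
  have h3 := (h2.eventually_lt_const hneg)
  obtain ⟨l, hl, hl2⟩ := (mem_nhdsLT_iff_exists_Ioo_subset' ha).1 h3
  have hpos : ∀ y ∈ Ioo l x, 0 < h1 y := by
    intro y hy
    have h4 : slope h1 x y < 0 := hl2 hy
    rw [slope_def_field, h1x, sub_zero] at h4
    by_contra! h5
    exact absurd h4 (not_lt.2 (div_nonneg_of_nonpos h5 (sub_nonpos.2 hy.2.le)))
  have hlx : max a l < x := max_lt ha hl
  have hmono : StrictMonoOn h (Icc (max a l) x) := by
    refine strictMonoOn_of_deriv_pos (convex_Icc _ _)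
      (fun y _ => (hh y).continuousAt.continuousWithinAt) ?_
    intro y hy
    rw [interior_Icc] at hy
    rw [(hh y).deriv]
    exact hpos y ⟨(le_max_right _ _).trans_lt hy.1, hy.2⟩
  have := hmono ⟨le_rfl, hlx.le⟩ ⟨hlx.le, le_rfl⟩ hlx
  exact absurd (hmin _ ⟨le_max_left a l, hlx.le⟩) (not_le.2 this)

theorem antitoneOn_Icc_of_hasDerivAt {h' : ℝ → ℝ} (hc : Continuous h)
    (hd : ∀ s ∈ Ioo a b, HasDerivAt h (h' s) s) (hn : ∀ s ∈ Ioo a b, h' s ≤ 0) :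
    AntitoneOn h (Icc a b) := by
  refine antitoneOn_of_deriv_nonpos (convex_Icc _ _) hc.continuousOn ?_ ?_ <;>
    rw [interior_Icc]
  · exact fun s hs => (hd s hs).differentiableAt.differentiableWithinAt
  · exact fun s hs => (hd s hs).deriv ▸ hn s hs

theorem monotoneOn_Icc_of_hasDerivAt {h' : ℝ → ℝ} (hc : Continuous h)
    (hd : ∀ s ∈ Ioo a b, HasDerivAt h (h' s) s) (hn : ∀ s ∈ Ioo a b, 0 ≤ h' s) :
    MonotoneOn h (Icc a b) := by
  refine monotoneOn_of_deriv_nonneg (convex_Icc _ _) hc.continuousOn ?_ ?_ <;>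
    rw [interior_Icc]
  · exact fun s hs => (hd s hs).differentiableAt.differentiableWithinAt
  · exact fun s hs => (hd s hs).deriv ▸ hn s hs

theorem nonneg_on_Icc_of_Ioo {h : ℝ → ℝ} (hab : a < b) (hc : Continuous h)
    (hn : ∀ y ∈ Ioo a b, 0 ≤ h y) : ∀ y ∈ Icc a b, 0 ≤ h y := by
  intro y hy
  have : Icc a b ⊆ {y | 0 ≤ h y} := by
    rw [← closure_Ioo hab.ne]
    exact closure_minimal hn (isClosed_le continuous_const hc)
  exact this hy

theorem eq_zero_on_Icc_of_Ioo {h : ℝ → ℝ} (hab : a < b) (hc : Continuous h)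
    (hn : ∀ y ∈ Ioo a b, h y = 0) : ∀ y ∈ Icc a b, h y = 0 := by
  intro y hy
  have : Icc a b ⊆ {y | h y = 0} := by
    rw [← closure_Ioo hab.ne]
    exact closure_minimal hn (isClosed_eq hc continuous_const)
  exact this hy

/-- A continuous function on a rectangle is nonnegative if it has no negative global minimum. -/
theorem nonneg_of_no_neg_min {w : ℝ → ℝ → ℝ} {a b L : ℝ} (hw : Continuous (uncurry w))
    (hmin : ∀ t ∈ Icc a b, ∀ x ∈ Icc 0 L,
      (∀ s ∈ Icc a b, ∀ y ∈ Icc 0 L, w t x ≤ w s y) → 0 ≤ w t x) :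
    ∀ t ∈ Icc a b, ∀ x ∈ Icc 0 L, 0 ≤ w t x := by
  intro t ht x hx
  obtain ⟨⟨t0, x0⟩, h0, hmin0⟩ := (isCompact_Icc.prod isCompact_Icc :
    IsCompact (Icc a b ×ˢ Icc 0 L)).exists_isMinOn ⟨(t, x), ht, hx⟩ hw.continuousOn
  have hle : ∀ s ∈ Icc a b, ∀ y ∈ Icc 0 L, w t0 x0 ≤ w s y :=
    fun s hs y hy => hmin0 (show (s, y) ∈ Icc a b ×ˢ Icc 0 L from ⟨hs, hy⟩)
  exact (hmin t0 h0.1 x0 h0.2 hle).trans (hle t ht x hx)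

end Extrema

section MaximumPrinciple

variable {T L σ r ε : ℝ} {uT m0 : ℝ → ℝ} {u m : ℝ → ℝ → ℝ}

theorem hasDerivAt_mfgG (h : IsMFGSolution T L σ r ε uT m0 u m) (t x : ℝ) :
    HasDerivAt (mfgG L ε u m t) (-(1/2) * pdxx u t x) x := by
  have := ((hasDerivAt_pdxx h.u_smooth t x).const_sub (mfgF L ε u m t)).const_mul (1/2 : ℝ)
  exact this.congr_deriv (by ring)

theorem continuous_mfgG (h : IsMFGSolution T L σ r ε uT m0 u m) (t : ℝ) :
    Continuous (mfgG L ε u m t) :=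
  continuous_iff_continuousAt.2 fun x => (hasDerivAt_mfgG h t x).continuousAt

theorem hjb_closed (hdata : MFGData T L σ r ε uT m0) (h : IsMFGSolution T L σ r ε uT m0 u m)
    {t x : ℝ} (ht : t ∈ Ioo 0 T) (hx : x ∈ Icc 0 L) :
    pdt u t x = r * u t x - σ^2/2 * pdxx u t x - (mfgG L ε u m t x)^2 := by
  have hc : Continuous fun x => pdt u t x + σ^2/2 * pdxx u t x - r * u t x
      + mfgH L ε u m t x := by
    have h1 := continuous_slice (contDiff_pdt h.u_smooth).continuous t
    have h2 := continuous_slice (contDiff_pdxx h.u_smooth).continuous t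
    have h3 := continuous_slice h.u_smooth.continuous t
    have h4 := continuous_mfgG h t
    unfold mfgH
    fun_prop
  have := eq_zero_on_Icc_of_Ioo hdata.hL hc (h.hjb t ht) x hx
  simp only [mfgH] at this
  linarith

theorem fp_closed (hdata : MFGData T L σ r ε uT m0) (h : IsMFGSolution T L σ r ε uT m0 u m)
    {t x : ℝ} (ht : t ∈ Ioo 0 T) (hx : x ∈ Icc 0 L) :
    pdt m t x = σ^2/2 * pdxx m t x + mfgG L ε u m t x * pdx m t x
      - 1/2 * pdxx u t x * m t x := by
  have hc : Continuous fun x => pdt m t x - σ^2/2 * pdxx m t x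
      - (mfgG L ε u m t x * pdx m t x - 1/2 * pdxx u t x * m t x) := by
    have h1 := continuous_slice (contDiff_pdt h.m_smooth).continuous t
    have h2 := continuous_slice (contDiff_pdxx h.m_smooth).continuous t
    have h3 := continuous_slice h.m_smooth.continuous t
    have h4 := continuous_mfgG h t
    have h5 := continuous_slice (contDiff_pdx h.m_smooth).continuous t
    have h6 := continuous_slice (contDiff_pdxx h.u_smooth).continuous t
    fun_prop
  have := eq_zero_on_Icc_of_Ioo hdata.hL hc (fun y hy => by
    have h1 := h.fp t ht y hy
    have h2 : HasDerivAt (fun y => mfgG L ε u m t y * m t y) _ y :=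
      (hasDerivAt_mfgG h t y).mul (hasDerivAt_pdx h.m_smooth t y)
    rw [h2.deriv] at h1
    linarith) x hx
  linarith

/-- The derivative in `x` of the Hamilton-Jacobi-Bellman equation. -/
theorem pdt_pdx_u (hdata : MFGData T L σ r ε uT m0) (h : IsMFGSolution T L σ r ε uT m0 u m)
    {t x : ℝ} (ht : t ∈ Ioo 0 T) (hx : x ∈ Icc 0 L) :
    pdt (pdx u) t x = r * pdx u t x - σ^2/2 * pdxx (pdx u) t x
      + mfgG L ε u m t x * pdxx u t x := by
  have hu1 := contDiff_pdx h.u_smooth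
  have hc : Continuous fun x => pdt (pdx u) t x - (r * pdx u t x - σ^2/2 * pdxx (pdx u) t x
      + mfgG L ε u m t x * pdxx u t x) := by
    have h1 := continuous_slice (contDiff_pdt hu1).continuous t
    have h2 := continuous_slice (contDiff_pdxx hu1).continuous t
    have h3 := continuous_slice hu1.continuous t
    have h4 := continuous_mfgG h t
    have h6 := continuous_slice (contDiff_pdxx h.u_smooth).continuous t
    fun_prop
  have := eq_zero_on_Icc_of_Ioo hdata.hL hc (fun y hy => by
    have h1 : HasDerivAt (fun y => r * u t y - σ^2/2 * pdxx u t y - (mfgG L ε u m t y)^2) _ y :=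
      (((hasDerivAt_pdx h.u_smooth t y).const_mul r).sub
        ((hasDerivAt_pdx (contDiff_pdxx h.u_smooth) t y).const_mul (σ^2/2))).sub
        ((hasDerivAt_mfgG h t y).pow 2)
    have h2 : HasDerivAt (fun y => r * u t y - σ^2/2 * pdxx u t y - (mfgG L ε u m t y)^2)
        (pdx (pdt u) t y) y := by
      refine (hasDerivAt_pdx (contDiff_pdt h.u_smooth) t y).congr_of_eventuallyEq ?_
      filter_upwards [isOpen_Ioo.mem_nhds hy] with z hz
      exact (hjb_closed hdata h ht ⟨hz.1.le, hz.2.le⟩).symm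
    have h3 := h2.unique h1
    have h4 : pdx (pdxx u) t y = pdxx (pdx u) t y := rfl
    rw [pdt_pdx_comm h.u_smooth, h3, h4]
    push_cast
    ring) x hx
  linarith

theorem m_nonneg_of_f_bound (hdata : MFGData T L σ r ε uT m0)
    (h : IsMFGSolution T L σ r ε uT m0 u m) {s K : ℝ} (hs : s < T)
    (hK : ∀ t ∈ Icc 0 s, |mfgF L ε u m t| ≤ K) :
    ∀ t ∈ Icc 0 s, ∀ x ∈ Icc 0 L, 0 ≤ m t x := by
  have hσ := hdata.hσ
  have hσ2 : 0 < σ^2 := by positivity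
  obtain ⟨K1, hK1⟩ := (isCompact_Icc.prod isCompact_Icc :
    IsCompact (Icc 0 s ×ˢ Icc 0 L)).exists_bound_of_continuousOn
      (contDiff_pdx h.u_smooth).continuous.continuousOn
  obtain ⟨K2, hK2⟩ := (isCompact_Icc.prod isCompact_Icc :
    IsCompact (Icc 0 s ×ˢ Icc 0 L)).exists_bound_of_continuousOn
      (contDiff_pdxx h.u_smooth).continuous.continuousOn
  set κ : ℝ := (|K| + 1) / σ^2 with hκ
  have hκ0 : 0 < κ := by positivity
  set α : ℝ := σ^2/2 * κ^2 + (|K| + |K1|) * κ + |K2| + 1 with hα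
  have hm := h.m_smooth.continuous
  have key := nonneg_of_no_neg_min (w := fun t x => m t x * Real.exp (-κ * x - α * t))
    (a := 0) (b := s) (L := L) (by
      have : (uncurry fun t x => m t x * Real.exp (-κ * x - α * t)) =
        fun z : ℝ × ℝ => uncurry m z * Real.exp (-κ * z.2 - α * z.1) := rfl
      rw [this]; fun_prop) ?_
  · intro t ht x hx
    exact nonneg_of_mul_nonneg_left (key t ht x hx) (Real.exp_pos _)
  intro t ht x hx hmin
  by_contra! hneg
  have hmneg : m t x < 0 := by
    by_contra! h0
    exact absurd hneg (not_lt.2 (mul_nonneg h0 (Real.exp_pos _).le))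
  have hE := Real.exp_pos (-κ * x - α * t)
  have ht0 : 0 < t := by
    rcases ht.1.eq_or_lt with h0 | h0
    · rw [← h0, h.m_init x hx] at hmneg
      exact absurd (hdata.m0_nonneg x hx) (not_le.2 hmneg)
    · exact h0
  have htT : t ∈ Ioo 0 T := ⟨ht0, ht.2.trans_lt hs⟩
  have hx0 : 0 < x := by
    rcases hx.1.eq_or_lt with h0 | h0
    · rw [← h0, h.m_bdry t ⟨ht0.le, htT.2.le⟩] at hmneg
      exact absurd hmneg (lt_irrefl _)
    · exact h0
  have hd1 : ∀ y, HasDerivAt (fun y => m t y * Real.exp (-κ * y - α * t))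
      ((pdx m t y - κ * m t y) * Real.exp (-κ * y - α * t)) y := fun y => by
    have he : HasDerivAt (fun y => Real.exp (-κ * y - α * t)) _ y :=
      (((hasDerivAt_id y).const_mul (-κ)).sub_const (α * t)).exp
    refine ((hasDerivAt_pdx h.m_smooth t y).mul he).congr_deriv ?_
    simp only [id]; ring
  have hleft := (hd1 x).nonpos_of_le_left hx0 fun y hy => hmin t ht y ⟨hy.1, hy.2.trans hx.2⟩
  have hleft' : pdx m t x - κ * m t x ≤ 0 := nonpos_of_mul_nonpos_left hleft hE
  have hf := abs_le.1 (hK t ht)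
  rcases hx.2.eq_or_lt with hxL | hxL
  · have h1 := h.m_flux t ⟨ht0.le, htT.2.le⟩
    subst hxL
    have h2 : mfgG x ε u m t x = 1/2 * mfgF x ε u m t := by
      rw [mfgG, h.ux_bdry t ⟨ht0.le, htT.2.le⟩, sub_zero]
    rw [h2] at h1
    have h3 : σ^2 * κ = |K| + 1 := by rw [hκ]; field_simp
    nlinarith [le_abs_self K, mul_pos_of_neg_of_neg hmneg
      (show -(mfgF x ε u m t + (|K| + 1)) < 0 by linarith [le_abs_self K])]
  · have hright := (hd1 x).nonneg_of_le_right hxL fun y hy =>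
      hmin t ht y ⟨hx.1.trans hy.1, hy.2⟩
    have h1 : pdx m t x = κ * m t x := by
      have := nonneg_of_mul_nonneg_left hright hE
      linarith
    have hd2 : HasDerivAt (fun y => (pdx m t y - κ * m t y) * Real.exp (-κ * y - α * t))
        ((pdxx m t x - κ^2 * m t x) * Real.exp (-κ * x - α * t)) x := by
      have he : HasDerivAt (fun y => Real.exp (-κ * y - α * t)) _ x :=
        (((hasDerivAt_id x).const_mul (-κ)).sub_const (α * t)).exp
      refine (((hasDerivAt_pdxx h.m_smooth t x).sub
        ((hasDerivAt_pdx h.m_smooth t x).const_mul κ)).mul he).congr_deriv ?_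
      simp only [id, Pi.sub_apply, h1]; ring
    have h2 := second_deriv_nonneg_of_le_left hd1 (by rw [h1]; ring) hd2 hx0
      fun y hy => hmin t ht y ⟨hy.1, hy.2.trans hx.2⟩
    have h2' := nonneg_of_mul_nonneg_left h2 hE
    have hdt : HasDerivAt (fun t => m t x * Real.exp (-κ * x - α * t))
        ((pdt m t x - α * m t x) * Real.exp (-κ * x - α * t)) t := by
      have he : HasDerivAt (fun t => Real.exp (-κ * x - α * t)) _ t :=
        (((hasDerivAt_id t).const_mul α).const_sub (-κ * x)).exp
      refine ((hasDerivAt_pdt h.m_smooth t x).mul he).congr_deriv ?_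
      simp only [id]; ring
    have h3 := hdt.nonpos_of_le_left ht0 fun y hy => hmin y ⟨hy.1, hy.2.trans ht.2⟩ x hx
    have h3' := nonpos_of_mul_nonpos_left h3 hE
    rw [fp_closed hdata h htT hx, h1] at h3'
    have hk1 := abs_le.1 (hK1 (t, x) ⟨ht, hx⟩)
    have hk2 := abs_le.1 (hK2 (t, x) ⟨ht, hx⟩)
    simp only [uncurry] at hk1 hk2
    have hG : mfgG L ε u m t x * κ ≤ (|K| + |K1|) * κ := by
      refine mul_le_mul_of_nonneg_right ?_ hκ0.le
      unfold mfgG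
      linarith [le_abs_self K, le_abs_self K1, abs_nonneg K, abs_nonneg K1]
    have hpos : 0 < α - σ^2/2 * κ^2 - mfgG L ε u m t x * κ + 1/2 * pdxx u t x := by
      linarith [le_abs_self K2, abs_nonneg K2]
    nlinarith [mul_neg_of_neg_of_pos hmneg hpos, mul_nonneg hσ2.le h2']

theorem continuous_mfgEta (h : IsMFGSolution T L σ r ε uT m0 u m) : Continuous (mfgEta L m) :=
  continuous_integral_slice h.m_smooth.continuous 0 L

theorem continuous_integral_ux_m (h : IsMFGSolution T L σ r ε uT m0 u m) :
    Continuous fun t => ∫ x in (0:ℝ)..L, pdx u t x * m t x :=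
  continuous_integral_slice (g := fun t x => pdx u t x * m t x)
    ((contDiff_pdx h.u_smooth).continuous.mul h.m_smooth.continuous) 0 L

theorem mfgEta_zero (hdata : MFGData T L σ r ε uT m0) (h : IsMFGSolution T L σ r ε uT m0 u m) :
    mfgEta L m 0 = 1 := by
  rw [← hdata.m0_mass, mfgEta]
  refine integral_congr fun x hx => h.m_init x ?_
  rwa [uIcc_of_le hdata.hL.le] at hx

theorem one_lt_denominator (hdata : MFGData T L σ r ε uT m0)
    (h : IsMFGSolution T L σ r ε uT m0 u m) :
    ∀ t ∈ Icc 0 T, 1 < 2 + ε * mfgEta L m t := by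
  by_contra! hbad
  have hη := continuous_mfgEta h
  have hclosed : IsClosed {t | t ∈ Icc 0 T ∧ 2 + ε * mfgEta L m t ≤ 1} :=
    isClosed_Icc.inter (isClosed_le (continuous_const.add (continuous_const.mul hη)) continuous_const)
  have hne : {t | t ∈ Icc 0 T ∧ 2 + ε * mfgEta L m t ≤ 1}.Nonempty := hbad
  have hbdd : BddBelow {t | t ∈ Icc 0 T ∧ 2 + ε * mfgEta L m t ≤ 1} := ⟨0, fun t ht => ht.1.1⟩
  obtain ⟨hτ, hτ1⟩ := hclosed.csInf_mem hne hbdd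
  set τ := sInf {t | t ∈ Icc 0 T ∧ 2 + ε * mfgEta L m t ≤ 1} with hτdef
  have hτ0 : 0 < τ := by
    rcases hτ.1.eq_or_lt with h0 | h0
    · rw [← h0, mfgEta_zero hdata h] at hτ1
      linarith [hdata.hε]
    · exact h0
  have hnon : ∀ s ∈ Ioo 0 τ, 0 ≤ mfgEta L m s := by
    intro s hs
    have hden : ∀ t ∈ Icc 0 s, 2 + ε * mfgEta L m t ≠ 0 := by
      intro t ht h0
      have : τ ≤ t := csInf_le hbdd ⟨⟨ht.1, ht.2.trans (hs.2.le.trans hτ.2)⟩, by linarith⟩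
      linarith [ht.2, hs.2]
    have hf : ContinuousOn (mfgF L ε u m) (Icc 0 s) := by
      have hp := continuous_integral_ux_m h
      have hd : ContinuousOn (fun t => 2 + ε * mfgEta L m t) (Icc 0 s) := by fun_prop
      exact (continuousOn_const.div hd hden).add ((continuousOn_const.div hd hden).mul
        hp.continuousOn)
    obtain ⟨K, hK⟩ := isCompact_Icc.exists_bound_of_continuousOn hf
    exact integral_nonneg hdata.hL.le fun x hx =>
      m_nonneg_of_f_bound hdata h (hs.2.trans_le hτ.2) hK s ⟨hs.1.le, le_rfl⟩ x hx
  have := nonneg_on_Icc_of_Ioo hτ0 hη hnon τ ⟨hτ0.le, le_rfl⟩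
  nlinarith [mul_nonneg hdata.hε this]

theorem m_nonneg (hdata : MFGData T L σ r ε uT m0) (h : IsMFGSolution T L σ r ε uT m0 u m) :
    ∀ t ∈ Icc 0 T, ∀ x ∈ Icc 0 L, 0 ≤ m t x := by
  intro t ht x hx
  have hf : ContinuousOn (mfgF L ε u m) (Icc 0 T) := by
    have hden : ∀ t ∈ Icc 0 T, 2 + ε * mfgEta L m t ≠ 0 := fun t ht =>
      (zero_lt_one.trans (one_lt_denominator hdata h t ht)).ne'
    have hη := continuous_mfgEta h
    have hp := continuous_integral_ux_m h
    have hd : ContinuousOn (fun t => 2 + ε * mfgEta L m t) (Icc 0 T) := by fun_prop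
    exact (continuousOn_const.div hd hden).add ((continuousOn_const.div hd hden).mul
      hp.continuousOn)
  obtain ⟨K, hK⟩ := isCompact_Icc.exists_bound_of_continuousOn hf
  refine nonneg_on_Icc_of_Ioo hdata.hT (h := fun s => m s x)
    (h.m_smooth.continuous.comp (Continuous.prodMk_left x)) (fun s hs => ?_) t ht
  exact m_nonneg_of_f_bound hdata h hs.2 (fun y hy => hK y ⟨hy.1, hy.2.trans hs.2.le⟩)
    s ⟨hs.1.le, le_rfl⟩ x hx

theorem mfgEta_nonneg (hdata : MFGData T L σ r ε uT m0)
    (h : IsMFGSolution T L σ r ε uT m0 u m) {t : ℝ} (ht : t ∈ Icc 0 T) : 0 ≤ mfgEta L m t :=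
  integral_nonneg hdata.hL.le (m_nonneg hdata h t ht)

theorem u_nonneg (hdata : MFGData T L σ r ε uT m0) (h : IsMFGSolution T L σ r ε uT m0 u m) :
    ∀ t ∈ Icc 0 T, ∀ x ∈ Icc 0 L, 0 ≤ u t x := by
  have hσ := hdata.hσ
  have key : ∀ s ∈ Ioo 0 T, ∀ t ∈ Icc s T, ∀ x ∈ Icc 0 L, 0 ≤ u t x := by
    intro s hs
    refine nonneg_of_no_neg_min h.u_smooth.continuous fun t ht x hx hmin => ?_
    have htT : t ∈ Icc 0 T := ⟨hs.1.le.trans ht.1, ht.2⟩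
    rcases ht.2.eq_or_lt with h0 | h0
    · rw [h0, h.u_term x hx]; exact hdata.uT_nonneg x hx
    rcases hx.1.eq_or_lt with h1 | h1
    · rw [← h1, h.u_bdry t htT]
    have hut := (hasDerivAt_pdt h.u_smooth t x).nonneg_of_le_right h0
      fun y hy => hmin y ⟨ht.1.trans hy.1, hy.2⟩ x hx
    have hux : pdx u t x = 0 := by
      rcases hx.2.eq_or_lt with h2 | h2
      · rw [h2, h.ux_bdry t htT]
      · exact le_antisymm
          ((hasDerivAt_pdx h.u_smooth t x).nonpos_of_le_left h1
            fun y hy => hmin t ht y ⟨hy.1, hy.2.trans hx.2⟩)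
          ((hasDerivAt_pdx h.u_smooth t x).nonneg_of_le_right h2
            fun y hy => hmin t ht y ⟨hx.1.trans hy.1, hy.2⟩)
    have huxx := second_deriv_nonneg_of_le_left (hasDerivAt_pdx h.u_smooth t) hux
      (hasDerivAt_pdxx h.u_smooth t x) h1 fun y hy => hmin t ht y ⟨hy.1, hy.2.trans hx.2⟩
    rw [hjb_closed hdata h ⟨hs.1.trans_le ht.1, h0⟩ hx] at hut
    have : 0 ≤ r * u t x := by nlinarith [mul_nonneg (sq_nonneg σ) huxx]
    exact nonneg_of_mul_nonneg_right this hdata.hr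
  intro t ht x hx
  exact nonneg_on_Icc_of_Ioo hdata.hT (h := fun s => u s x)
    (h.u_smooth.continuous.comp (Continuous.prodMk_left x))
    (fun s hs => key s hs s ⟨le_rfl, hs.2.le⟩ x hx) t ht

theorem pdx_u_term (hdata : MFGData T L σ r ε uT m0) (h : IsMFGSolution T L σ r ε uT m0 u m)
    {x : ℝ} (hx : x ∈ Icc 0 L) : pdx u T x = deriv uT x := by
  have hc : Continuous fun x => pdx u T x - deriv uT x :=
    (continuous_slice (contDiff_pdx h.u_smooth).continuous T).sub
      (hdata.uT_smooth.continuous_deriv (by norm_num))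
  refine sub_eq_zero.1 (eq_zero_on_Icc_of_Ioo hdata.hL hc (fun y hy => sub_eq_zero.2 ?_) x hx)
  refine Filter.EventuallyEq.deriv_eq ?_
  filter_upwards [isOpen_Ioo.mem_nhds hy] with z hz
  exact h.u_term z ⟨hz.1.le, hz.2.le⟩

theorem pdx_u_nonneg (hdata : MFGData T L σ r ε uT m0)
    (h : IsMFGSolution T L σ r ε uT m0 u m) :
    ∀ t ∈ Icc 0 T, ∀ x ∈ Icc 0 L, 0 ≤ pdx u t x := by
  have hσ := hdata.hσ
  have hv := contDiff_pdx h.u_smooth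
  have key : ∀ s ∈ Ioo 0 T, ∀ t ∈ Icc s T, ∀ x ∈ Icc 0 L, 0 ≤ pdx u t x := by
    intro s hs
    refine nonneg_of_no_neg_min hv.continuous fun t ht x hx hmin => ?_
    have htT : t ∈ Icc 0 T := ⟨hs.1.le.trans ht.1, ht.2⟩
    rcases ht.2.eq_or_lt with h0 | h0
    · rw [h0, pdx_u_term hdata h hx]; exact hdata.uT_deriv_nonneg x hx
    rcases hx.1.eq_or_lt with h1 | h1
    · rw [← h1]
      refine (hasDerivAt_pdx h.u_smooth t 0).nonneg_of_le_right hdata.hL fun y hy => ?_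
      rw [h.u_bdry t htT]
      exact u_nonneg hdata h t htT y hy
    rcases hx.2.eq_or_lt with h2 | h2
    · rw [h2, h.ux_bdry t htT]
    have hut := (hasDerivAt_pdt hv t x).nonneg_of_le_right h0
      fun y hy => hmin y ⟨ht.1.trans hy.1, hy.2⟩ x hx
    have hux : pdxx u t x = 0 := le_antisymm
      ((hasDerivAt_pdx hv t x).nonpos_of_le_left h1
        fun y hy => hmin t ht y ⟨hy.1, hy.2.trans hx.2⟩)
      ((hasDerivAt_pdx hv t x).nonneg_of_le_right h2
        fun y hy => hmin t ht y ⟨hx.1.trans hy.1, hy.2⟩)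
    have huxx := second_deriv_nonneg_of_le_left (hasDerivAt_pdx hv t) hux
      (hasDerivAt_pdxx hv t x) h1 fun y hy => hmin t ht y ⟨hy.1, hy.2.trans hx.2⟩
    rw [pdt_pdx_u hdata h ⟨hs.1.trans_le ht.1, h0⟩ hx, hux] at hut
    have : 0 ≤ r * pdx u t x := by nlinarith [mul_nonneg (sq_nonneg σ) huxx]
    exact nonneg_of_mul_nonneg_right this hdata.hr
  intro t ht x hx
  exact nonneg_on_Icc_of_Ioo hdata.hT (h := fun s => pdx u s x)
    (hv.continuous.comp (Continuous.prodMk_left x))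
    (fun s hs => key s hs s ⟨le_rfl, hs.2.le⟩ x hx) t ht

end MaximumPrinciple

section WeightedIntegral

/-- The integral of `g` against the density `m t`. -/
noncomputable def densityIntegral (L : ℝ) (m : ℝ → ℝ → ℝ) (t : ℝ) (g : ℝ → ℝ) : ℝ :=
  ∫ x in (0:ℝ)..L, g x * m t x

variable {L t : ℝ} {m : ℝ → ℝ → ℝ}

theorem densityIntegral_linear {g1 g2 g3 : ℝ → ℝ} (hm : Continuous (m t))
    (h1 : Continuous g1) (h2 : Continuous g2) (h3 : Continuous g3) (a b c d : ℝ) :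
    densityIntegral L m t (fun x => a * g1 x + b * g2 x + c * g3 x + d)
      = a * densityIntegral L m t g1 + b * densityIntegral L m t g2
        + c * densityIntegral L m t g3 + d * mfgEta L m t := by
  unfold densityIntegral mfgEta
  rw [← intervalIntegral.integral_const_mul, ← intervalIntegral.integral_const_mul,
    ← intervalIntegral.integral_const_mul, ← intervalIntegral.integral_const_mul,
    ← intervalIntegral.integral_add, ← intervalIntegral.integral_add,
    ← intervalIntegral.integral_add]
  · exact integral_congr fun x _ => by ring
  all_goals exact Continuous.intervalIntegrable (by fun_prop) _ _

theorem densityIntegral_mono {g1 g2 : ℝ → ℝ} (hL : 0 ≤ L) (hm : Continuous (m t))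
    (hpos : ∀ x ∈ Icc 0 L, 0 ≤ m t x) (h1 : Continuous g1) (h2 : Continuous g2)
    (hle : ∀ x ∈ Icc 0 L, g1 x ≤ g2 x) :
    densityIntegral L m t g1 ≤ densityIntegral L m t g2 :=
  integral_mono_on hL ((h1.mul hm).intervalIntegrable _ _) ((h2.mul hm).intervalIntegrable _ _)
    fun x hx => mul_le_mul_of_nonneg_right (hle x hx) (hpos x hx)

theorem densityIntegral_nonneg {g : ℝ → ℝ} (hL : 0 ≤ L) (hpos : ∀ x ∈ Icc 0 L, 0 ≤ m t x)
    (hg : ∀ x ∈ Icc 0 L, 0 ≤ g x) : 0 ≤ densityIntegral L m t g :=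
  integral_nonneg hL fun x hx => mul_nonneg (hg x hx) (hpos x hx)

theorem continuous_densityIntegral {g : ℝ → ℝ → ℝ} (hg : Continuous (uncurry g))
    (hm : Continuous (uncurry m)) : Continuous fun t => densityIntegral L m t (g t) :=
  continuous_integral_slice (g := fun t x => g t x * m t x) (hg.mul hm) 0 L

end WeightedIntegral

section Energy

variable {T L σ r ε : ℝ} {uT m0 : ℝ → ℝ} {u m : ℝ → ℝ → ℝ}

/-- The weak form of the Fokker-Planck equation. -/
theorem hasDerivAt_densityIntegral (hdata : MFGData T L σ r ε uT m0)
    (h : IsMFGSolution T L σ r ε uT m0 u m) {g : ℝ → ℝ → ℝ}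
    (hg : ContDiff ℝ (⊤ : ℕ∞) (uncurry g)) {t : ℝ} (ht : t ∈ Ioo 0 T) :
    HasDerivAt (fun s => densityIntegral L m s (g s))
      (densityIntegral L m t
          (fun x => pdt g t x + σ^2/2 * pdxx g t x - mfgG L ε u m t x * pdx g t x)
        - g t 0 * (σ^2/2 * pdx m t 0) - σ^2/2 * pdx g t L * m t L) t := by
  have hgm : ContDiff ℝ (⊤ : ℕ∞) (uncurry fun t x => g t x * m t x) := hg.mul h.m_smooth
  refine (hasDerivAt_integral_pdt hgm 0 L t).congr_deriv ?_
  have c1 := continuous_slice hg.continuous t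
  have c2 := continuous_slice (contDiff_pdx hg).continuous t
  have c3 := continuous_slice (contDiff_pdxx hg).continuous t
  have c4 := continuous_slice (contDiff_pdt hg).continuous t
  have c5 := continuous_slice h.m_smooth.continuous t
  have c6 := continuous_slice (contDiff_pdx h.m_smooth).continuous t
  have c7 := continuous_slice (contDiff_pdt h.m_smooth).continuous t
  have c8 := continuous_mfgG h t
  have hflux : ∀ x ∈ uIcc 0 L, HasDerivAt
      (fun x => g t x * (σ^2/2 * pdx m t x + mfgG L ε u m t x * m t x)
        - σ^2/2 * pdx g t x * m t x)
      (mfgG L ε u m t x * pdx g t x * m t x + g t x * pdt m t x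
        - σ^2/2 * pdxx g t x * m t x) x := by
    intro x hx
    rw [uIcc_of_le hdata.hL.le] at hx
    have d1 := hasDerivAt_pdx hg t x
    have d2 := hasDerivAt_pdxx hg t x
    have d3 := hasDerivAt_pdx h.m_smooth t x
    have d4 := hasDerivAt_pdxx h.m_smooth t x
    have d5 := hasDerivAt_mfgG h t x
    refine ((d1.mul ((d4.const_mul (σ^2/2)).add (d5.mul d3))).sub
      ((d2.const_mul (σ^2/2)).mul d3)).congr_deriv ?_
    rw [fp_closed hdata h ht hx]
    simp only [Pi.add_apply, Pi.mul_apply]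
    ring
  have hint := integral_eq_sub_of_hasDerivAt hflux
    (Continuous.intervalIntegrable (by fun_prop) _ _)
  have htI : t ∈ Icc 0 T := ⟨ht.1.le, ht.2.le⟩
  simp only [h.m_flux t htI, h.m_bdry t htI, mul_zero, add_zero, zero_sub, sub_zero] at hint
  have hsplit : ∫ x in (0:ℝ)..L, pdt (fun t x => g t x * m t x) t x =
      densityIntegral L m t
          (fun x => pdt g t x + σ^2/2 * pdxx g t x - mfgG L ε u m t x * pdx g t x)
        + ∫ x in (0:ℝ)..L, (mfgG L ε u m t x * pdx g t x * m t x + g t x * pdt m t x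
        - σ^2/2 * pdxx g t x * m t x) := by
    unfold densityIntegral
    rw [← intervalIntegral.integral_add (Continuous.intervalIntegrable (by fun_prop) _ _)
      (Continuous.intervalIntegrable (by fun_prop) _ _)]
    refine integral_congr fun x _ => ?_
    have : pdt (fun t x => g t x * m t x) t x = _ :=
      ((hasDerivAt_pdt hg t x).mul (hasDerivAt_pdt h.m_smooth t x)).deriv
    simp only [this]
    ring
  rw [hsplit, hint]
  ring

theorem pdx_m_zero_nonneg (hdata : MFGData T L σ r ε uT m0)
    (h : IsMFGSolution T L σ r ε uT m0 u m) {t : ℝ} (ht : t ∈ Icc 0 T) : 0 ≤ pdx m t 0 :=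
  (hasDerivAt_pdx h.m_smooth t 0).nonneg_of_le_right hdata.hL fun y hy => by
    rw [h.m_bdry t ht]; exact m_nonneg hdata h t ht y hy

theorem mfgEta_le_one (hdata : MFGData T L σ r ε uT m0)
    (h : IsMFGSolution T L σ r ε uT m0 u m) {t : ℝ} (ht : t ∈ Icc 0 T) : mfgEta L m t ≤ 1 := by
  rw [← mfgEta_zero hdata h]
  refine antitoneOn_Icc_of_hasDerivAt (h' := fun s => -(σ^2/2 * pdx m s 0))
    (continuous_mfgEta h) (fun s hs => ?_) (fun s hs => ?_) ⟨le_rfl, hdata.hT.le⟩ ht ht.1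
  · have h1 := hasDerivAt_densityIntegral hdata h (g := fun _ _ => 1) contDiff_const hs
    change HasDerivAt (fun s => ∫ x in (0:ℝ)..L, m s x) _ s
    simpa [densityIntegral, pdt, pdx, pdxx] using h1
  · have := pdx_m_zero_nonneg hdata h ⟨hs.1.le, hs.2.le⟩
    have : 0 ≤ σ^2/2 * pdx m s 0 := by positivity
    linarith

theorem mfgF_mul_eq (hdata : MFGData T L σ r ε uT m0)
    (h : IsMFGSolution T L σ r ε uT m0 u m) {t : ℝ} (ht : t ∈ Icc 0 T) :
    mfgF L ε u m t * (2 + ε * mfgEta L m t) = 2 + ε * densityIntegral L m t (pdx u t) := by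
  have : 2 + ε * mfgEta L m t ≠ 0 := (zero_lt_one.trans (one_lt_denominator hdata h t ht)).ne'
  unfold mfgF densityIntegral
  field_simp

theorem mfgF_sq_bounds (hdata : MFGData T L σ r ε uT m0)
    (h : IsMFGSolution T L σ r ε uT m0 u m) {t : ℝ} (ht : t ∈ Icc 0 T) :
    mfgF L ε u m t ^ 2 ≤ 1 + ε / 2 * densityIntegral L m t (fun x => pdx u t x ^ 2) ∧
    (2 + ε) * (mfgEta L m t * mfgF L ε u m t ^ 2)
      ≤ 2 + ε * densityIntegral L m t (fun x => pdx u t x ^ 2) := by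
  have hm := continuous_slice h.m_smooth.continuous t
  have hv := continuous_slice (contDiff_pdx h.u_smooth).continuous t
  have h1 := mfgF_mul_eq hdata h ht
  have h2 : 0 ≤ densityIntegral L m t (fun x => (1:ℝ) * (pdx u t x ^ 2)
      + (-2 * mfgF L ε u m t) * pdx u t x + 0 * pdx u t x + mfgF L ε u m t ^ 2) :=
    densityIntegral_nonneg hdata.hL.le (m_nonneg hdata h t ht) fun x _ => by
      nlinarith [sq_nonneg (pdx u t x - mfgF L ε u m t)]
  rw [densityIntegral_linear hm (by fun_prop) hv hv] at h2
  have hη := mfgEta_nonneg hdata h ht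
  have hη1 := mfgEta_le_one hdata h ht
  have hε := hdata.hε
  set f := mfgF L ε u m t
  set η := mfgEta L m t
  set E := densityIntegral L m t (fun x => pdx u t x ^ 2)
  set p := densityIntegral L m t (pdx u t)
  have h3 : f^2 + ε * η / 2 * f^2 = f + ε / 2 * (f * p) := by linear_combination f / 2 * h1
  have h4 := mul_nonneg hε h2
  have h5 : f^2 / 2 + ε / 4 * (η * f^2) ≤ 1 / 2 + ε / 4 * E := by
    nlinarith [sq_nonneg (f - 1)]
  have h6 : 0 ≤ ε * (η * f^2) := by positivity
  have h7 : η * f^2 ≤ f^2 := mul_le_of_le_one_left (sq_nonneg f) hη1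
  constructor <;> linarith

theorem energy_u (hdata : MFGData T L σ r ε uT m0)
    (h : IsMFGSolution T L σ r ε uT m0 u m) {t : ℝ} (ht : t ∈ Ioo 0 T) :
    DifferentiableAt ℝ (fun s => densityIntegral L m s (u s)) t ∧
    densityIntegral L m t (fun x => pdx u t x ^ 2) ≤
      1 + 2 * (2 + ε) * deriv (fun s => densityIntegral L m s (u s)) t := by
  have htI : t ∈ Icc 0 T := ⟨ht.1.le, ht.2.le⟩
  have hd := hasDerivAt_densityIntegral hdata h h.u_smooth ht
  refine ⟨hd.differentiableAt, ?_⟩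
  rw [hd.deriv, h.u_bdry t htI, h.ux_bdry t htI]
  have hm := continuous_slice h.m_smooth.continuous t
  have hu := continuous_slice h.u_smooth.continuous t
  have hv := continuous_slice (contDiff_pdx h.u_smooth).continuous t
  have ht' := continuous_slice (contDiff_pdt h.u_smooth).continuous t
  have hvx := continuous_slice (contDiff_pdxx h.u_smooth).continuous t
  have hG := continuous_mfgG h t
  have h1 : densityIntegral L m t (fun x => (1/4 : ℝ) * (pdx u t x ^ 2) + 0 * u t x + 0 * u t x
      + -(mfgF L ε u m t ^ 2 / 4)) ≤ densityIntegral L m t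
        (fun x => pdt u t x + σ^2/2 * pdxx u t x - mfgG L ε u m t x * pdx u t x) := by
    refine densityIntegral_mono hdata.hL.le hm (m_nonneg hdata h t htI) (by fun_prop)
      (by fun_prop) fun x hx => ?_
    rw [hjb_closed hdata h ht hx]
    have := mul_nonneg hdata.hr.le (u_nonneg hdata h t htI x hx)
    unfold mfgG
    linarith
  rw [densityIntegral_linear hm (by fun_prop) hu hu] at h1
  have h2 := (mfgF_sq_bounds hdata h htI).2
  have hε := hdata.hε
  have h3 := mul_le_mul_of_nonneg_left h1 (show 0 ≤ 2 * (2 + ε) by positivity)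
  linarith

theorem energy_weighted_sq (hdata : MFGData T L σ r ε uT m0)
    (h : IsMFGSolution T L σ r ε uT m0 u m) {t : ℝ} (ht : t ∈ Ioo 0 T) :
    DifferentiableAt ℝ (fun s => densityIntegral L m s (fun x => x^2 * pdx u s x ^ 2)) t ∧
    σ^2/2 * densityIntegral L m t (fun x => x^2 * pdxx u t x ^ 2)
      - (7 * σ^2 + 1/2) * densityIntegral L m t (fun x => pdx u t x ^ 2)
      - mfgF L ε u m t ^ 2 / 2 * densityIntegral L m t (fun x => x^2 * pdx u t x ^ 2) ≤
      deriv (fun s => densityIntegral L m s (fun x => x^2 * pdx u s x ^ 2)) t := by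
  have htI : t ∈ Icc 0 T := ⟨ht.1.le, ht.2.le⟩
  have hu1 := contDiff_pdx h.u_smooth
  set g : ℝ → ℝ → ℝ := fun s x => x^2 * pdx u s x ^ 2 with hgdef
  have hg : ContDiff ℝ (⊤ : ℕ∞) (uncurry g) := (contDiff_snd.pow 2).mul (hu1.pow 2)
  have hd := hasDerivAt_densityIntegral hdata h hg ht
  refine ⟨hd.differentiableAt, ?_⟩
  have hgx : ∀ x, pdx g t x = 2 * x * pdx u t x ^ 2 + 2 * x^2 * (pdx u t x * pdxx u t x) :=
    fun x => by
      refine HasDerivAt.deriv (((hasDerivAt_pow 2 x).mul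
        ((hasDerivAt_pdxx h.u_smooth t x).pow 2)).congr_deriv ?_)
      simp only [Pi.pow_apply]; push_cast; ring
  have hgxx : ∀ x, pdxx g t x = 2 * pdx u t x ^ 2 + 8 * x * (pdx u t x * pdxx u t x)
      + 2 * x^2 * (pdxx u t x ^ 2 + pdx u t x * pdxx (pdx u) t x) := fun x => by
    have hfun : pdx g t = _ := funext hgx
    unfold pdxx
    change deriv (pdx g t) x = _
    rw [hfun]
    have d0 := hasDerivAt_pdxx h.u_smooth t x
    have d1 := hasDerivAt_pdxx hu1 t x
    refine HasDerivAt.deriv (((((hasDerivAt_id x).const_mul 2).mul (d0.pow 2)).add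
      (((hasDerivAt_pow 2 x).const_mul 2).mul (d0.mul d1))).congr_deriv ?_)
    simp only [id, Pi.pow_apply, Pi.mul_apply]
    change _ = 2 * pdx u t x ^ 2 + 8 * x * (pdx u t x * pdxx u t x)
      + 2 * x^2 * (pdxx u t x ^ 2 + pdx u t x * pdxx (pdx u) t x)
    have e : pdx (pdx u) t x = pdxx u t x := rfl
    simp only [e]
    push_cast; ring
  have hgt : ∀ x, pdt g t x = 2 * x^2 * (pdx u t x * pdt (pdx u) t x) := fun x => by
    refine HasDerivAt.deriv ((((hasDerivAt_pdt hu1 t x).pow 2).const_mul (x^2)).congr_deriv ?_)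
    push_cast; ring
  have hm := continuous_slice h.m_smooth.continuous t
  have hv := continuous_slice hu1.continuous t
  have hvx := continuous_slice (contDiff_pdxx h.u_smooth).continuous t
  have c1 := continuous_slice (contDiff_pdt hg).continuous t
  have c2 := continuous_slice (contDiff_pdx hg).continuous t
  have c3 := continuous_slice (contDiff_pdxx hg).continuous t
  have hG := continuous_mfgG h t
  rw [hd.deriv, hgx L, h.ux_bdry t htI]
  have h1 : densityIntegral L m t (fun x => σ^2/2 * (x^2 * pdxx u t x ^ 2)
      + (-(7 * σ^2 + 1/2)) * (pdx u t x ^ 2)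
      + (-(mfgF L ε u m t ^ 2 / 2)) * (x^2 * pdx u t x ^ 2) + 0) ≤ densityIntegral L m t
        (fun x => pdt g t x + σ^2/2 * pdxx g t x - mfgG L ε u m t x * pdx g t x) := by
    refine densityIntegral_mono hdata.hL.le hm (m_nonneg hdata h t htI) (by fun_prop)
      (by fun_prop) fun x hx => ?_
    rw [hgx, hgxx, hgt, pdt_pdx_u hdata h ht hx]
    have hv0 := pdx_u_nonneg hdata h t htI x hx
    have hx0 := hx.1
    have hr := hdata.hr
    unfold mfgG
    set f := mfgF L ε u m t
    set v := pdx u t x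
    set vx := pdxx u t x
    have p1 : 0 ≤ r * (x^2 * v^2) := by positivity
    have p2 : 0 ≤ x * v^3 := by positivity
    have p3 : 0 ≤ σ^2 / 2 * (x * vx + 4 * v)^2 := by positivity
    have p4 : 0 ≤ v^2 / 2 * (x * f - 1)^2 := by positivity
    linarith
  rw [densityIntegral_linear hm (by fun_prop) (by fun_prop) (by fun_prop)] at h1
  simp only [hgdef] at h1 ⊢
  linarith

theorem energy_linear (hdata : MFGData T L σ r ε uT m0)
    (h : IsMFGSolution T L σ r ε uT m0 u m) {t : ℝ} (ht : t ∈ Ioo 0 T) :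
    DifferentiableAt ℝ
      (fun s => densityIntegral L m s (fun x => (1 - x^2 / L^2) * pdx u s x)) t ∧
    deriv (fun s => densityIntegral L m s (fun x => (1 - x^2 / L^2) * pdx u s x)) t ≤
      (r + 1 / (2 * L)) * densityIntegral L m t (fun x => pdx u t x ^ 2)
      + σ^2 / L^2 * densityIntegral L m t (fun x => x^2 * pdxx u t x ^ 2)
      + (r + σ^2 / L^2 + mfgF L ε u m t ^ 2 / (2 * L)) := by
  have htI : t ∈ Icc 0 T := ⟨ht.1.le, ht.2.le⟩
  have hL := hdata.hL
  have hr := hdata.hr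
  have hu1 := contDiff_pdx h.u_smooth
  set g : ℝ → ℝ → ℝ := fun s x => (1 - x^2 / L^2) * pdx u s x with hgdef
  have hg : ContDiff ℝ (⊤ : ℕ∞) (uncurry g) :=
    (contDiff_const.sub ((contDiff_snd.pow 2).div_const _)).mul hu1
  have hd := hasDerivAt_densityIntegral hdata h hg ht
  refine ⟨hd.differentiableAt, ?_⟩
  have hgx : ∀ x, pdx g t x = -(2 * x / L^2) * pdx u t x + (1 - x^2 / L^2) * pdxx u t x :=
    fun x => by
      refine HasDerivAt.deriv (((((hasDerivAt_pow 2 x).div_const (L^2)).const_sub 1).mul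
        (hasDerivAt_pdxx h.u_smooth t x)).congr_deriv ?_)
      push_cast; ring
  have hgxx : ∀ x, pdxx g t x = -(2 / L^2) * pdx u t x - 4 * x / L^2 * pdxx u t x
      + (1 - x^2 / L^2) * pdxx (pdx u) t x := fun x => by
    have hfun : pdx g t = _ := funext hgx
    have d0 := hasDerivAt_pdxx h.u_smooth t x
    have d1 : HasDerivAt (pdxx u t) (pdxx (pdx u) t x) x := hasDerivAt_pdxx hu1 t x
    change deriv (pdx g t) x = _
    rw [hfun]
    refine HasDerivAt.deriv (((((((hasDerivAt_id x).const_mul 2).div_const (L^2)).neg).mul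
      d0).add ((((hasDerivAt_pow 2 x).div_const (L^2)).const_sub 1).mul d1)).congr_deriv ?_)
    simp only [id, Pi.neg_apply]
    push_cast; ring
  have hgt : ∀ x, pdt g t x = (1 - x^2 / L^2) * pdt (pdx u) t x := fun x =>
    ((hasDerivAt_pdt hu1 t x).const_mul (1 - x^2 / L^2)).deriv
  have hm := continuous_slice h.m_smooth.continuous t
  have hv := continuous_slice hu1.continuous t
  have hvx := continuous_slice (contDiff_pdxx h.u_smooth).continuous t
  have c1 := continuous_slice (contDiff_pdt hg).continuous t
  have c2 := continuous_slice (contDiff_pdx hg).continuous t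
  have c3 := continuous_slice (contDiff_pdxx hg).continuous t
  have hG := continuous_mfgG h t
  have hgL : pdx g t L = 0 := by
    rw [hgx L, h.ux_bdry t htI]
    field_simp
    ring
  have hg0 : g t 0 = pdx u t 0 := by simp [hgdef]
  rw [hd.deriv, hgL, hg0]
  have h1 : densityIntegral L m t
        (fun x => pdt g t x + σ^2/2 * pdxx g t x - mfgG L ε u m t x * pdx g t x) ≤
      densityIntegral L m t (fun x => (r + 1 / (2 * L)) * (pdx u t x ^ 2)
      + σ^2 / L^2 * (x^2 * pdxx u t x ^ 2) + 0 * pdx u t x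
      + (r + σ^2 / L^2 + mfgF L ε u m t ^ 2 / (2 * L))) := by
    refine densityIntegral_mono hL.le hm (m_nonneg hdata h t htI) (by fun_prop)
      (by fun_prop) fun x hx => ?_
    rw [hgx, hgxx, hgt, pdt_pdx_u hdata h ht hx]
    have hv0 := pdx_u_nonneg hdata h t htI x hx
    have hx0 := hx.1
    have hLx : 0 ≤ L - x := sub_nonneg.2 hx.2
    unfold mfgG
    set f := mfgF L ε u m t
    set v := pdx u t x
    set vx := pdxx u t x
    have p1 : 0 ≤ r * (x^2 / L^2 * v) := by positivity
    have p2 : 0 ≤ r * ((v - 1/2)^2 + 3/4) := by positivity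
    have p3 : 0 ≤ σ^2 / L^2 * (x * vx + 1)^2 := by positivity
    have p4 : 0 ≤ σ^2 / L^2 * v := by positivity
    have p5 : 0 ≤ x / L^2 * v^2 := by positivity
    have p6 : 0 ≤ x / L^2 * (f - v)^2 := by positivity
    have p7 : 0 ≤ (L - x) / L^2 * (f^2 + v^2) := by positivity
    have e : 1 / (2 * L) = 1/2 * (L / L^2) := by field_simp
    have e2 : f^2 / (2 * L) = 1/2 * (L / L^2) * f^2 := by field_simp
    rw [e, e2]
    ring_nf at p1 p2 p3 p4 p5 p6 p7 ⊢
    linarith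
  rw [densityIntegral_linear hm (by fun_prop) (by fun_prop) (by fun_prop)] at h1
  have h2 := mfgEta_le_one hdata h htI
  have h3 : 0 ≤ r + σ^2 / L^2 + mfgF L ε u m t ^ 2 / (2 * L) := by positivity
  have h4 := mul_le_of_le_one_right h3 h2
  have h5 := pdx_m_zero_nonneg hdata h htI
  have h6 := pdx_u_nonneg hdata h t htI 0 ⟨le_rfl, hL.le⟩
  have h7 : 0 ≤ pdx u t 0 * (σ^2/2 * pdx m t 0) := by positivity
  linarith

end Energy

section Bounds

variable {T L σ r ε : ℝ} {uT m0 : ℝ → ℝ} {u m : ℝ → ℝ → ℝ}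

theorem densityIntegral_le_of_le (hdata : MFGData T L σ r ε uT m0)
    (h : IsMFGSolution T L σ r ε uT m0 u m) {t K : ℝ} {g : ℝ → ℝ} (ht : t ∈ Icc 0 T)
    (hK : 0 ≤ K) (hg : Continuous g) (hle : ∀ x ∈ Icc 0 L, g x ≤ K) :
    densityIntegral L m t g ≤ K := by
  have hm := continuous_slice h.m_smooth.continuous t
  have h1 := densityIntegral_mono hdata.hL.le hm (m_nonneg hdata h t ht) hg
    (continuous_const (y := K)) hle
  have h2 : densityIntegral L m t (fun _ => K) = K * mfgEta L m t := by
    unfold densityIntegral mfgEta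
    rw [intervalIntegral.integral_const_mul]
  rw [h2] at h1
  exact h1.trans (mul_le_of_le_one_right hK (mfgEta_le_one hdata h ht))

theorem densityIntegral_u_nonneg (hdata : MFGData T L σ r ε uT m0)
    (h : IsMFGSolution T L σ r ε uT m0 u m) {t : ℝ} (ht : t ∈ Icc 0 T) :
    0 ≤ densityIntegral L m t (u t) :=
  densityIntegral_nonneg hdata.hL.le (m_nonneg hdata h t ht) (u_nonneg hdata h t ht)

theorem densityIntegral_ux_sq_nonneg (hdata : MFGData T L σ r ε uT m0)
    (h : IsMFGSolution T L σ r ε uT m0 u m) {t : ℝ} (ht : t ∈ Icc 0 T) :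
    0 ≤ densityIntegral L m t (fun x => pdx u t x ^ 2) :=
  densityIntegral_nonneg hdata.hL.le (m_nonneg hdata h t ht) fun _ _ => sq_nonneg _

theorem continuous_densityIntegral_u (h : IsMFGSolution T L σ r ε uT m0 u m) :
    Continuous fun s => densityIntegral L m s (u s) :=
  continuous_densityIntegral h.u_smooth.continuous h.m_smooth.continuous

theorem densityIntegral_u_le (hdata : MFGData T L σ r ε uT m0)
    (h : IsMFGSolution T L σ r ε uT m0 u m) {K : ℝ} (hK : 0 ≤ K)
    (huT : ∀ x ∈ Icc 0 L, uT x ≤ K) {t : ℝ} (ht : t ∈ Icc 0 T) :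
    densityIntegral L m t (u t) ≤ K + T := by
  have hε := hdata.hε
  have hmono := monotoneOn_Icc_of_hasDerivAt (a := 0) (b := T)
    (h := fun s => s + 2 * (2 + ε) * densityIntegral L m s (u s))
    (continuous_id.add ((continuous_densityIntegral_u h).const_mul _))
    (fun s hs => (hasDerivAt_id s).add
      ((energy_u hdata h hs).1.hasDerivAt.const_mul (2 * (2 + ε))))
    (fun s hs => (densityIntegral_ux_sq_nonneg hdata h ⟨hs.1.le, hs.2.le⟩).trans
      (energy_u hdata h hs).2)
  have hT : T ∈ Icc 0 T := ⟨hdata.hT.le, le_rfl⟩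
  have h1 := hmono ht hT ht.2
  have h2 : densityIntegral L m T (u T) ≤ K :=
    densityIntegral_le_of_le hdata h hT hK (continuous_slice h.u_smooth.continuous T)
      fun x hx => by rw [h.u_term x hx]; exact huT x hx
  simp only at h1
  have h3 : 2 * (2 + ε) * densityIntegral L m t (u t) ≤ 2 * (2 + ε) * (K + T) := by
    nlinarith [mul_le_mul_of_nonneg_left h2 (show 0 ≤ 2 * (2 + ε) by positivity), ht.1,
      mul_nonneg hε hdata.hT.le, hdata.hT]
  exact le_of_mul_le_mul_left h3 (by positivity)

theorem mfgF_sq_le_deriv (hdata : MFGData T L σ r ε uT m0)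
    (h : IsMFGSolution T L σ r ε uT m0 u m) {t : ℝ} (ht : t ∈ Ioo 0 T) :
    mfgF L ε u m t ^ 2 ≤ 1 + ε / 2
      + ε * (2 + ε) * deriv (fun s => densityIntegral L m s (u s)) t := by
  have h1 := (mfgF_sq_bounds hdata h ⟨ht.1.le, ht.2.le⟩).1
  have h2 := mul_le_mul_of_nonneg_left (energy_u hdata h ht).2
    (show 0 ≤ ε / 2 by linarith [hdata.hε])
  linarith

theorem u_le (hdata : MFGData T L σ r ε uT m0) (h : IsMFGSolution T L σ r ε uT m0 u m)
    {K : ℝ} (hK : 0 ≤ K) (huT : ∀ x ∈ Icc 0 L, uT x ≤ K) :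
    ∀ t ∈ Icc 0 T, ∀ x ∈ Icc 0 L,
      u t x ≤ K + 1/4 * ((1 + ε / 2) * T + ε * (2 + ε) * (K + T)) := by
  have hσ := hdata.hσ
  have hε := hdata.hε
  set a : ℝ := 1 + ε / 2
  set b : ℝ := ε * (2 + ε)
  have ha : 0 ≤ a := by positivity
  have hb : 0 ≤ b := by positivity
  set M : ℝ := K + 1/4 * (a * T + b * (K + T)) with hM
  set B : ℝ → ℝ := fun s => densityIntegral L m s (u s) with hB
  have hBc : Continuous B := continuous_densityIntegral_u h
  have hphi : ∀ t ∈ Icc 0 T, 1/4 * (a * t + b * B t) ≤ M - K := by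
    intro t ht
    have h1 := mul_le_mul_of_nonneg_left ht.2 ha
    have h2 := mul_le_mul_of_nonneg_left (densityIntegral_u_le hdata h hK huT ht) hb
    simp only [hB, hM]
    linarith
  have key : ∀ s ∈ Ioo 0 T, ∀ t ∈ Icc s T, ∀ x ∈ Icc 0 L,
      0 ≤ M - u t x - 1/4 * (a * t + b * B t) := by
    intro s hs
    refine nonneg_of_no_neg_min (w := fun t x => M - u t x - 1/4 * (a * t + b * B t)) ?_
      fun t ht x hx hmin => ?_
    · have hu := h.u_smooth.continuous
      have : (uncurry fun t x => M - u t x - 1/4 * (a * t + b * B t)) =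
        fun z : ℝ × ℝ => M - uncurry u z - 1/4 * (a * z.1 + b * B z.1) := rfl
      rw [this]; fun_prop
    have htT : t ∈ Icc 0 T := ⟨hs.1.le.trans ht.1, ht.2⟩
    have hφ := hphi t htT
    rcases ht.2.eq_or_lt with h0 | h0
    · have : u t x ≤ K := by rw [h0, h.u_term x hx]; exact huT x hx
      linarith
    rcases hx.1.eq_or_lt with h1 | h1
    · have : u t x = 0 := by rw [← h1, h.u_bdry t htT]
      linarith
    have htO : t ∈ Ioo 0 T := ⟨hs.1.trans_le ht.1, h0⟩
    have hBd := (energy_u hdata h htO).1.hasDerivAt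
    have hwt := (((hasDerivAt_pdt h.u_smooth t x).const_sub M).sub
      ((((hasDerivAt_id t).const_mul a).add (hBd.const_mul b)).const_mul (1/4))).nonneg_of_le_right
        h0 fun y hy => hmin y ⟨ht.1.trans hy.1, hy.2⟩ x hx
    have hdx : ∀ y, HasDerivAt (fun y => M - u t y - 1/4 * (a * t + b * B t)) (-pdx u t y) y :=
      fun y => ((hasDerivAt_pdx h.u_smooth t y).const_sub M).sub_const _
    have hux : pdx u t x = 0 := by
      rcases hx.2.eq_or_lt with h2 | h2
      · rw [h2, h.ux_bdry t htT]
      · have e1 := (hdx x).nonpos_of_le_left h1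
            fun y hy => hmin t ht y ⟨hy.1, hy.2.trans hx.2⟩
        have e2 := (hdx x).nonneg_of_le_right h2
            fun y hy => hmin t ht y ⟨hx.1.trans hy.1, hy.2⟩
        linarith
    have huxx := second_deriv_nonneg_of_le_left hdx (by rw [hux, neg_zero])
      (hasDerivAt_pdxx h.u_smooth t x).neg h1 fun y hy => hmin t ht y ⟨hy.1, hy.2.trans hx.2⟩
    have hpde := hjb_closed hdata h htO hx
    have hf : mfgF L ε u m t ^ 2 ≤ a + b * deriv (fun s => densityIntegral L m s (u s)) t :=
      mfgF_sq_le_deriv hdata h htO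
    rw [mfgG, hux, sub_zero] at hpde
    have : 0 ≤ σ^2 * -pdxx u t x := mul_nonneg (sq_nonneg σ) huxx
    have h3 : r * u t x ≤ 0 := by
      simp only [mul_one] at hwt
      linarith
    have h4 : u t x ≤ 0 := nonpos_of_mul_nonpos_right h3 hdata.hr
    linarith
  intro t ht x hx
  have h1 := nonneg_on_Icc_of_Ioo hdata.hT
    (h := fun s => M - u s x - 1/4 * (a * s + b * B s)) (by
      have := h.u_smooth.continuous.comp (Continuous.prodMk_left x)
      simp only [Function.comp_def, uncurry] at this
      fun_prop)
    (fun s hs => key s hs s ⟨le_rfl, hs.2.le⟩ x hx) t ht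
  have h2 := densityIntegral_u_nonneg hdata h ht
  have h3 : 0 ≤ 1/4 * (a * t + b * B t) := by
    have := ht.1
    have : 0 ≤ B t := h2
    positivity
  linarith

/-- A function controlling the weighted energy: its derivative dominates the dissipation. -/
theorem exists_energy_majorant (hdata : MFGData T L σ r ε uT m0) {K K1 : ℝ} (hK : 0 ≤ K)
    (huT : ∀ x ∈ Icc 0 L, uT x ≤ K) (huT1 : ∀ x ∈ Icc 0 L, |deriv uT x| ≤ K1) :
    ∃ C : ℝ, 0 ≤ C ∧ ∀ u m : ℝ → ℝ → ℝ, IsMFGSolution T L σ r ε uT m0 u m →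
      ∃ D : ℝ → ℝ, Continuous D ∧ (∀ t ∈ Icc 0 T, D t ≤ C) ∧
        (∀ t ∈ Icc 0 T, densityIntegral L m t (fun x => x^2 * pdx u t x ^ 2) ≤ D t) ∧
        ∀ t ∈ Ioo 0 T, DifferentiableAt ℝ D t ∧
          σ^2/2 * densityIntegral L m t (fun x => x^2 * pdxx u t x ^ 2) ≤ deriv D t := by
  have hσ := hdata.hσ
  have hε := hdata.hε
  have hT := hdata.hT
  set a : ℝ := 1 + ε / 2 with ha_def
  set b : ℝ := ε * (2 + ε) with hb_def
  have ha : 0 ≤ a := by positivity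
  have hb : 0 ≤ b := by positivity
  set N : ℝ := Real.exp (1/2 * (a * T + b * (K + T))) with hN
  have hN0 : 0 < N := Real.exp_pos _
  set c : ℝ := 7 * σ^2 + 1/2 with hc
  have hc0 : 0 < c := by positivity
  refine ⟨N * (L^2 * K1^2) + c * N * (T + 2 * (2 + ε) * (K + T)), by positivity, ?_⟩
  intro u m h
  have hu1 := contDiff_pdx h.u_smooth
  set B : ℝ → ℝ := fun s => densityIntegral L m s (u s) with hB
  set Y : ℝ → ℝ := fun s => densityIntegral L m s (fun x => x^2 * pdx u s x ^ 2) with hY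
  have hBc : Continuous B := continuous_densityIntegral_u h
  have hYc : Continuous Y :=
    continuous_densityIntegral (g := fun s x => x^2 * pdx u s x ^ 2)
      ((continuous_snd.pow 2).mul (hu1.continuous.pow 2)) h.m_smooth.continuous
  have hB0 : ∀ t ∈ Icc 0 T, 0 ≤ B t := fun t ht => densityIntegral_u_nonneg hdata h ht
  have hB1 : ∀ t ∈ Icc 0 T, B t ≤ K + T := fun t ht => densityIntegral_u_le hdata h hK huT ht
  have hY0 : ∀ t ∈ Icc 0 T, 0 ≤ Y t := fun t ht =>
    densityIntegral_nonneg hdata.hL.le (m_nonneg hdata h t ht) fun _ _ => by positivity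
  set W : ℝ → ℝ := fun s => Real.exp (1/2 * (a * s + b * B s)) with hW
  have hW1 : ∀ t ∈ Icc 0 T, 1 ≤ W t := fun t ht => by
    have := ht.1
    have := hB0 t ht
    exact Real.one_le_exp (by positivity)
  have hWN : ∀ t ∈ Icc 0 T, W t ≤ N := fun t ht => by
    refine Real.exp_le_exp.2 ?_
    have h1 := mul_le_mul_of_nonneg_left ht.2 ha
    have h2 := mul_le_mul_of_nonneg_left (hB1 t ht) hb
    linarith
  set D : ℝ → ℝ := fun s => W s * Y s + c * N * (s + 2 * (2 + ε) * B s) with hD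
  have hDc : Continuous D := by simp only [hD, hW]; fun_prop
  have hderiv : ∀ t ∈ Ioo 0 T, DifferentiableAt ℝ D t ∧
      σ^2/2 * densityIntegral L m t (fun x => x^2 * pdxx u t x ^ 2) ≤ deriv D t := by
    intro t ht
    have htI : t ∈ Icc 0 T := ⟨ht.1.le, ht.2.le⟩
    obtain ⟨hB', hBE⟩ := energy_u hdata h ht
    obtain ⟨hY', hYE⟩ := energy_weighted_sq hdata h ht
    have hf : mfgF L ε u m t ^ 2 ≤ a + b * deriv B t := mfgF_sq_le_deriv hdata h ht
    have hWd : HasDerivAt W (W t * (1/2 * (a + b * deriv B t))) t := by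
      have := ((((hasDerivAt_id t).const_mul a).add
        (hB'.hasDerivAt.const_mul b)).const_mul (1/2)).exp
      exact this.congr_deriv (by simp only [hW, hB, id, Pi.add_apply, mul_one])
    have hDd := (hWd.mul hY'.hasDerivAt).add
      (((hasDerivAt_id t).add (hB'.hasDerivAt.const_mul (2 * (2 + ε)))).const_mul (c * N))
    refine ⟨hDd.differentiableAt, ?_⟩
    change _ ≤ deriv (fun s => W s * Y s + c * N * (s + 2 * (2 + ε) * B s)) t
    rw [show deriv (fun s => W s * Y s + c * N * (s + 2 * (2 + ε) * B s)) t = _ from hDd.deriv]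
    have hW1t := hW1 t htI
    have hW0 : 0 ≤ W t := zero_le_one.trans hW1t
    have hE0 := densityIntegral_ux_sq_nonneg hdata h htI
    have hZ0 : 0 ≤ densityIntegral L m t (fun x => x^2 * pdxx u t x ^ 2) :=
      densityIntegral_nonneg hdata.hL.le (m_nonneg hdata h t htI) fun _ _ => by positivity
    set Z := densityIntegral L m t (fun x => x^2 * pdxx u t x ^ 2)
    set E := densityIntegral L m t (fun x => pdx u t x ^ 2)
    change E ≤ 1 + 2 * (2 + ε) * deriv B t at hBE
    change σ^2/2 * Z - c * E - mfgF L ε u m t ^ 2 / 2 * Y t ≤ deriv Y t at hYE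
    change _ ≤ W t * (1/2 * (a + b * deriv B t)) * Y t + W t * deriv Y t
      + c * N * (1 + 2 * (2 + ε) * deriv B t)
    have e1 := mul_le_mul_of_nonneg_left hYE hW0
    have e2 := mul_le_mul_of_nonneg_left hf (mul_nonneg hW0 (hY0 t htI))
    have e3 := mul_le_mul_of_nonneg_left hBE (mul_nonneg hc0.le hN0.le)
    have e4 := mul_le_mul_of_nonneg_right (hWN t htI) (mul_nonneg hc0.le hE0)
    have e5 := mul_le_mul_of_nonneg_right hW1t
      (mul_nonneg (show 0 ≤ σ^2/2 by positivity) hZ0)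
    linarith
  have hmono : MonotoneOn D (Icc 0 T) := monotoneOn_Icc_of_hasDerivAt hDc
    (fun s hs => (hderiv s hs).1.hasDerivAt) fun s hs => le_trans (mul_nonneg (by positivity)
      (densityIntegral_nonneg hdata.hL.le (m_nonneg hdata h s ⟨hs.1.le, hs.2.le⟩)
        fun _ _ => by positivity)) (hderiv s hs).2
  have hTI : T ∈ Icc 0 T := ⟨hT.le, le_rfl⟩
  refine ⟨D, hDc, fun t ht => (hmono ht hTI ht.2).trans ?_, fun t ht => ?_, hderiv⟩
  · have hYT : Y T ≤ L^2 * K1^2 := by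
      refine densityIntegral_le_of_le hdata h hTI (by positivity)
        ((continuous_id.pow 2).mul ((continuous_slice hu1.continuous T).pow 2)) fun x hx => ?_
      rw [pdx_u_term hdata h hx]
      have := huT1 x hx
      refine mul_le_mul (pow_le_pow_left₀ hx.1 hx.2 2) ?_ (sq_nonneg _) (by positivity)
      exact sq_le_sq.2 (this.trans (le_abs_self K1))
    have h1 := mul_le_mul (hWN T hTI) hYT (hY0 T hTI) hN0.le
    have h2 := mul_le_mul_of_nonneg_left (hB1 T hTI) (show 0 ≤ c * N * (2 * (2 + ε)) by positivity)
    simp only [hD]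
    linarith
  · have h1 := mul_le_mul_of_nonneg_right (hW1 t ht) (hY0 t ht)
    have h2 := hB0 t ht
    have h3 := ht.1
    have h4 : 0 ≤ c * N * (t + 2 * (2 + ε) * B t) := by positivity
    simp only [hD]
    linarith

theorem exists_bound_initial_linear (hdata : MFGData T L σ r ε uT m0) (Ku : ℝ) :
    ∃ C : ℝ, ∀ u m : ℝ → ℝ → ℝ, IsMFGSolution T L σ r ε uT m0 u m →
      (∀ x ∈ Icc 0 L, u 0 x ≤ Ku) →
      densityIntegral L m 0 (fun x => (1 - x^2 / L^2) * pdx u 0 x) ≤ C := by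
  have hL := hdata.hL
  set ψ : ℝ → ℝ := fun x => (1 - x^2 / L^2) * m0 x with hψ
  have hψs : ContDiff ℝ 2 ψ :=
    (contDiff_const.sub ((contDiff_id.pow 2).div_const _)).mul hdata.m0_smooth
  have hψ' : Continuous (deriv ψ) := hψs.continuous_deriv (by norm_num)
  obtain ⟨K2, hK2⟩ := isCompact_Icc.exists_bound_of_continuousOn
    (hψ'.continuousOn (s := Icc 0 L))
  refine ⟨|K2| * Ku * L, fun u m h hu => ?_⟩
  have hu0 := continuous_slice h.u_smooth.continuous 0
  have hv0 := continuous_slice (contDiff_pdx h.u_smooth).continuous 0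
  have h1 : densityIntegral L m 0 (fun x => (1 - x^2 / L^2) * pdx u 0 x) =
      ∫ x in (0:ℝ)..L, ψ x * pdx u 0 x := by
    refine integral_congr fun x hx => ?_
    rw [uIcc_of_le hL.le] at hx
    simp only [h.m_init x hx, hψ]
    ring
  rw [h1, integral_mul_deriv_eq_deriv_mul (u' := deriv ψ) (v := u 0)
    (fun x _ => (hψs.differentiable (by norm_num) x).hasDerivAt)
    (fun x _ => hasDerivAt_pdx h.u_smooth 0 x) (hψ'.intervalIntegrable _ _)
    (hv0.intervalIntegrable _ _)]
  have h2 : ψ L = 0 := by simp [hψ, hdata.m0_L]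
  have h3 : ψ 0 = 0 := by simp [hψ, hdata.m0_zero]
  rw [h2, h3, zero_mul, zero_mul, sub_zero, zero_sub, ← intervalIntegral.integral_neg]
  have h4 : ∫ x in (0:ℝ)..L, -(deriv ψ x * u 0 x) ≤ ∫ _ in (0:ℝ)..L, |K2| * Ku := by
    refine integral_mono_on hL.le (Continuous.intervalIntegrable (by fun_prop) _ _)
      (continuous_const.intervalIntegrable _ _) fun x hx => ?_
    have e1 := u_nonneg hdata h 0 ⟨le_rfl, hdata.hT.le⟩ x hx
    have e2 : -deriv ψ x ≤ |K2| :=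
      (neg_le_abs _).trans ((hK2 x hx).trans (le_abs_self K2))
    rw [← neg_mul]
    exact mul_le_mul e2 (hu x hx) e1 (abs_nonneg _)
  refine h4.trans (le_of_eq ?_)
  rw [intervalIntegral.integral_const, smul_eq_mul]
  ring

theorem exists_bound_integral_ux_m (hdata : MFGData T L σ r ε uT m0) :
    ∃ C : ℝ, ∀ u m : ℝ → ℝ → ℝ, IsMFGSolution T L σ r ε uT m0 u m →
      ∀ t ∈ Icc 0 T, densityIntegral L m t (pdx u t) ≤ C := by
  have hL := hdata.hL
  have hσ := hdata.hσ
  have hε := hdata.hε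
  have hT := hdata.hT
  have hr := hdata.hr
  obtain ⟨K', hK'⟩ := isCompact_Icc.exists_bound_of_continuousOn
    (hdata.uT_smooth.continuous.continuousOn (s := Icc 0 L))
  have huT : ∀ x ∈ Icc 0 L, uT x ≤ |K'| := fun x hx =>
    (le_abs_self _).trans ((hK' x hx).trans (le_abs_self _))
  obtain ⟨K1, hK1⟩ := isCompact_Icc.exists_bound_of_continuousOn
    ((hdata.uT_smooth.continuous_deriv (by norm_num)).continuousOn (s := Icc 0 L))
  obtain ⟨CD, hCD0, hCD⟩ := exists_energy_majorant hdata (abs_nonneg K') huT hK1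
  obtain ⟨C0, hC0⟩ := exists_bound_initial_linear hdata
    (|K'| + 1/4 * ((1 + ε / 2) * T + ε * (2 + ε) * (|K'| + T)))
  set a : ℝ := r + 1 / (2 * L)
  set k : ℝ := σ^2 / L^2
  have ha : 0 ≤ a := by positivity
  have hk : 0 ≤ k := by positivity
  set c0 : ℝ := a + (r + k + (1 + ε / 2) / (2 * L))
  set c1 : ℝ := a * (2 * (2 + ε)) + ε * (2 + ε) / (2 * L)
  have hc0 : 0 ≤ c0 := by positivity
  have hc1 : 0 ≤ c1 := by positivity
  refine ⟨C0 + (c0 * T + c1 * (|K'| + T) + 2 / L^2 * CD) + 1 / L^2 * (L^2 + CD),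
    fun u m h t ht => ?_⟩
  obtain ⟨D, hDc, hDle, hYD, hD'⟩ := hCD u m h
  have hu1 := contDiff_pdx h.u_smooth
  set B : ℝ → ℝ := fun s => densityIntegral L m s (u s) with hB
  set q : ℝ → ℝ := fun s => densityIntegral L m s (fun x => (1 - x^2 / L^2) * pdx u s x) with hq
  have hBc : Continuous B := continuous_densityIntegral_u h
  have hqc : Continuous q :=
    continuous_densityIntegral (g := fun s x => (1 - x^2 / L^2) * pdx u s x)
      ((continuous_const.sub ((continuous_snd.pow 2).div_const _)).mul hu1.continuous)
      h.m_smooth.continuous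
  have hanti := antitoneOn_Icc_of_hasDerivAt (a := 0) (b := T)
    (h := fun s => q s - (c0 * s + c1 * B s + 2 / L^2 * D s)) (by fun_prop)
    (fun s hs => (energy_linear hdata h hs).1.hasDerivAt.sub
      ((((hasDerivAt_id s).const_mul c0).add
        ((energy_u hdata h hs).1.hasDerivAt.const_mul c1)).add
        ((hD' s hs).1.hasDerivAt.const_mul (2 / L^2))))
    (fun s hs => by
      have e1 := (energy_linear hdata h hs).2
      have e2 := mul_le_mul_of_nonneg_left (energy_u hdata h hs).2 ha
      have e3 := mul_le_mul_of_nonneg_left (mfgF_sq_le_deriv hdata h hs)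
        (show 0 ≤ 1 / (2 * L) by positivity)
      have e4 := mul_le_mul_of_nonneg_left (hD' s hs).2 (show 0 ≤ 2 / L^2 by positivity)
      change deriv q s ≤ a * densityIntegral L m s (fun x => pdx u s x ^ 2)
        + k * densityIntegral L m s (fun x => x^2 * pdxx u s x ^ 2)
        + (r + k + mfgF L ε u m s ^ 2 / (2 * L)) at e1
      change a * _ ≤ a * (1 + 2 * (2 + ε) * deriv B s) at e2
      change _ ≤ 1 / (2 * L) * (1 + ε / 2 + ε * (2 + ε) * deriv B s) at e3
      change deriv q s - (c0 * 1 + c1 * deriv B s + 2 / L^2 * deriv D s) ≤ 0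
      have e5 : 2 / L^2 * (σ^2/2 * densityIntegral L m s (fun x => x^2 * pdxx u s x ^ 2)) =
          k * densityIntegral L m s (fun x => x^2 * pdxx u s x ^ 2) := by
        simp only [k]; ring
      have e6 : c0 * 1 + c1 * deriv B s = a * (1 + 2 * (2 + ε) * deriv B s)
          + (r + k + 1 / (2 * L) * (1 + ε / 2 + ε * (2 + ε) * deriv B s)) := by
        simp only [c0, c1]; ring
      have e7 : mfgF L ε u m s ^ 2 / (2 * L) = 1 / (2 * L) * mfgF L ε u m s ^ 2 := by ring
      rw [e5] at e4
      rw [e7] at e1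
      rw [e6]
      linarith)
  have h0 : (0:ℝ) ∈ Icc 0 T := ⟨le_rfl, hT.le⟩
  have h1 := hanti h0 ht ht.1
  simp only at h1
  have hq0 : q 0 ≤ C0 := hC0 u m h (u_le hdata h (abs_nonneg K') huT 0 h0)
  have hB0 := mul_nonneg hc1 (densityIntegral_u_nonneg hdata h h0)
  have hD0 : 0 ≤ 2 / L^2 * D 0 := mul_nonneg (by positivity) (le_trans
    (densityIntegral_nonneg hL.le (m_nonneg hdata h 0 h0) fun _ _ => by positivity) (hYD 0 h0))
  have hBt := mul_le_mul_of_nonneg_left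
    (densityIntegral_u_le hdata h (abs_nonneg K') huT ht) hc1
  have hDt := mul_le_mul_of_nonneg_left (hDle t ht) (show 0 ≤ 2 / L^2 by positivity)
  have htT := mul_le_mul_of_nonneg_left ht.2 hc0
  have hv := continuous_slice hu1.continuous t
  have hm := continuous_slice h.m_smooth.continuous t
  have hp : densityIntegral L m t (pdx u t) ≤ densityIntegral L m t (fun x =>
      1 * ((1 - x^2 / L^2) * pdx u t x) + 1 / L^2 * (x^2 * pdx u t x ^ 2) + 0 * pdx u t x + 1) := by
    refine densityIntegral_mono hL.le hm (m_nonneg hdata h t ht) hv (by fun_prop)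
      fun x hx => ?_
    have hxL : x^2 / L^2 ≤ 1 := by
      rw [div_le_one (by positivity)]
      exact pow_le_pow_left₀ hx.1 hx.2 2
    have e1 : 0 ≤ x^2 / L^2 * ((pdx u t x - 1/2)^2 + 3/4) := by positivity
    ring_nf at e1 hxL ⊢
    linarith
  rw [densityIntegral_linear hm (by fun_prop) (by fun_prop) hv] at hp
  have hη := mfgEta_le_one hdata h ht
  have hYt := mul_le_mul_of_nonneg_left ((hYD t ht).trans (hDle t ht))
    (show 0 ≤ 1 / L^2 by positivity)
  have e : 1 / L^2 * (L^2 + CD) = 1 + 1 / L^2 * CD := by field_simp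
  rw [e]
  have hqt : q t = densityIntegral L m t (fun x => (1 - x^2 / L^2) * pdx u t x) := rfl
  simp only [hB] at h1 hBt hB0
  linarith

end Bounds

/-- the quantity f(t) = a(η(t)) + c(η(t)) p̄(t) is uniformly bounded
by a constant depending only on the data. -/
theorem mfg_f_bound (T L σ r ε : ℝ) (uT m0 : ℝ → ℝ)
    (hdata : MFGData T L σ r ε uT m0) :
    ∃ C : ℝ, 0 < C ∧
      ∀ u m : ℝ → ℝ → ℝ, IsMFGSolution T L σ r ε uT m0 u m →
        ∀ t ∈ Icc (0:ℝ) T, |mfgF L ε u m t| ≤ C := by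
  have hε := hdata.hε
  obtain ⟨C, hC⟩ := exists_bound_integral_ux_m hdata
  refine ⟨1 + ε / 2 * |C|, by positivity, fun u m h t ht => ?_⟩
  have hp := hC u m h t ht
  have hp0 : 0 ≤ densityIntegral L m t (pdx u t) :=
    densityIntegral_nonneg hdata.hL.le (m_nonneg hdata h t ht) (pdx_u_nonneg hdata h t ht)
  have hη := mul_nonneg hε (mfgEta_nonneg hdata h ht)
  have hf := mfgF_mul_eq hdata h ht
  have hf0 : 0 ≤ mfgF L ε u m t := by
    refine nonneg_of_mul_nonneg_left (b := 2 + ε * mfgEta L m t) ?_ (by linarith)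
    rw [hf]
    positivity
  rw [abs_of_nonneg hf0]
  nlinarith [mul_nonneg hf0 hη, mul_le_mul_of_nonneg_left (hp.trans (le_abs_self C)) hε]
end

section
/- Suppose (u₁,m₁) and (u₂,m₂) are two classical solutions of the MFG system with the same data. Then ∫₀^T ∫₀^L e^{−rt} [ (H₁(t,x) − H₂(t,x))(m₁(t,x) − m₂(t,x)) + (G₁(t,x) m₁(t,x) − G₂(t,x) m₂(t,x))(∂_x u₁(t,x) − ∂_x u₂(t,x)) ] dx dt = 0, where for i = 1,2, G_i(t,x) = (1/2)(f_i(t) − ∂_x u_i(t,x)), H_i = G_i², and f_i(t) = 2/(2 + ε η_i(t)) + (ε/(2 + ε η_i(t))) ∫₀^L ∂_x u_i(t,x) m_i(t,x) dx with η_i(t) = ∫₀^L m_i(t,x) dx. -/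
open Set MeasureTheory intervalIntegral Function

noncomputable section

/-- A classical solution: `C¹` in time, `C²` in space, with derivatives
continuous up to the boundary. -/
structure IsMFGClassicalSolution (T L σ r ε : ℝ) (uT m0 : ℝ → ℝ)
    (u m : ℝ → ℝ → ℝ) : Prop where
  u_diff_t : ∀ x, Differentiable ℝ (fun t => u t x)
  u_diff_x : ∀ t, Differentiable ℝ (u t)
  u_diff_xx : ∀ t, Differentiable ℝ (deriv (u t))
  u_cont_t : Continuous (uncurry (pdt u))
  u_cont_x : Continuous (uncurry (pdx u))
  u_cont_xx : Continuous (uncurry (pdxx u))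
  m_diff_t : ∀ x, Differentiable ℝ (fun t => m t x)
  m_diff_x : ∀ t, Differentiable ℝ (m t)
  m_diff_xx : ∀ t, Differentiable ℝ (deriv (m t))
  m_cont_t : Continuous (uncurry (pdt m))
  m_cont_x : Continuous (uncurry (pdx m))
  m_cont_xx : Continuous (uncurry (pdxx m))
  hjb : ∀ t ∈ Ioo (0:ℝ) T, ∀ x ∈ Ioo (0:ℝ) L,
    pdt u t x + σ^2/2 * pdxx u t x - r * u t x + mfgH L ε u m t x = 0
  fp : ∀ t ∈ Ioo (0:ℝ) T, ∀ x ∈ Ioo (0:ℝ) L,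
    pdt m t x - σ^2/2 * pdxx m t x
      - deriv (fun y => mfgG L ε u m t y * m t y) x = 0
  m_init : ∀ x ∈ Icc (0:ℝ) L, m 0 x = m0 x
  u_term : ∀ x ∈ Icc (0:ℝ) L, u T x = uT x
  u_bdry : ∀ t ∈ Icc (0:ℝ) T, u t 0 = 0
  m_bdry : ∀ t ∈ Icc (0:ℝ) T, m t 0 = 0
  ux_bdry : ∀ t ∈ Icc (0:ℝ) T, pdx u t L = 0
  m_flux : ∀ t ∈ Icc (0:ℝ) T,
    σ^2/2 * pdx m t L + mfgG L ε u m t L * m t L = 0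

end

/-- A function that is differentiable in each variable and whose spatial derivative is
jointly continuous is itself jointly continuous. -/
lemma continuous_uncurry_of_continuous_pdx {u : ℝ → ℝ → ℝ}
    (ht : ∀ x, Differentiable ℝ (fun t => u t x)) (hx : ∀ t, Differentiable ℝ (u t))
    (hcx : Continuous (uncurry (pdx u))) : Continuous (uncurry u) := by
  have hprim : Continuous fun p : ℝ × ℝ => ∫ y in (0:ℝ)..p.2, pdx u p.1 y :=
    intervalIntegral.continuous_parametric_intervalIntegral_of_continuous
      (f := fun (p : ℝ × ℝ) y => pdx u p.1 y)
      (hcx.comp (by fun_prop : Continuous fun q : (ℝ × ℝ) × ℝ => (q.1.1, q.2))) continuous_snd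
  have hbase : Continuous fun p : ℝ × ℝ => u p.1 0 := (ht 0).continuous.comp continuous_fst
  refine (hbase.add hprim).congr fun p => ?_
  have hint : ∫ y in (0:ℝ)..p.2, pdx u p.1 y = u p.1 p.2 - u p.1 0 :=
    integral_deriv_eq_sub (fun y _ => hx p.1 y)
      ((hcx.comp (Continuous.prodMk_right p.1)).intervalIntegrable _ _)
  simp [hint, uncurry]

/-- The spatial derivative of the flux `G m`. -/
lemma hasDerivAt_mfgG_mul {L ε : ℝ} {u m : ℝ → ℝ → ℝ} {t : ℝ}
    (huxx : Differentiable ℝ (deriv (u t))) (hm : Differentiable ℝ (m t)) (x : ℝ) :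
    HasDerivAt (fun y => mfgG L ε u m t y * m t y)
      (-(1/2) * pdxx u t x * m t x + mfgG L ε u m t x * pdx m t x) x := by
  have hG : HasDerivAt (fun y => mfgG L ε u m t y) ((1/2) * (0 - pdxx u t x)) x :=
    ((hasDerivAt_const x (mfgF L ε u m t)).sub (huxx x).hasDerivAt).const_mul _
  refine (hG.mul (hm x).hasDerivAt).congr_deriv ?_
  simp only [pdx]
  ring

/-- The integral over a rectangle of the time derivative of a function vanishing at
the initial and final times is zero. -/
lemma integral_integral_deriv_eq_zero {T L : ℝ} {W D : ℝ → ℝ → ℝ}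
    (hL : 0 ≤ L) (hD : Continuous (uncurry D))
    (hW : ∀ t x, HasDerivAt (fun s => W s x) (D t x) t)
    (h0 : ∀ x ∈ Icc 0 L, W 0 x = 0) (hT : ∀ x ∈ Icc 0 L, W T x = 0) :
    ∫ t in (0:ℝ)..T, ∫ x in (0:ℝ)..L, D t x = 0 := by
  rw [intervalIntegral_intervalIntegral_swap]
  · refine (integral_congr (g := fun _ => (0:ℝ)) fun x hx => ?_).trans
      intervalIntegral.integral_zero
    rw [uIcc_of_le hL] at hx
    change ∫ t in (0:ℝ)..T, D t x = 0
    rw [integral_eq_sub_of_hasDerivAt (fun t _ => hW t x)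
      ((hD.comp (Continuous.prodMk_left x)).intervalIntegrable _ _), h0 x hx, hT x hx, sub_zero]
  · exact (hD.continuousOn.integrableOn_compact (isCompact_uIcc.prod isCompact_uIcc)).mono_set
      (prod_mono uIoc_subset_uIcc uIoc_subset_uIcc)

/-- the energy identity for two classical solutions. -/
theorem mfg_energy_identity (T L σ r ε : ℝ) (uT m0 : ℝ → ℝ)
    (hdata : MFGData T L σ r ε uT m0)
    (u₁ m₁ u₂ m₂ : ℝ → ℝ → ℝ)
    (hsol₁ : IsMFGClassicalSolution T L σ r ε uT m0 u₁ m₁)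
    (hsol₂ : IsMFGClassicalSolution T L σ r ε uT m0 u₂ m₂) :
    (∫ t in (0:ℝ)..T, ∫ x in (0:ℝ)..L, Real.exp (-(r * t)) *
      ((mfgH L ε u₁ m₁ t x - mfgH L ε u₂ m₂ t x) * (m₁ t x - m₂ t x)
        + (mfgG L ε u₁ m₁ t x * m₁ t x - mfgG L ε u₂ m₂ t x * m₂ t x)
          * (pdx u₁ t x - pdx u₂ t x))) = 0 := by
  obtain ⟨hut₁, hux₁, huxx₁, hcut₁, hcux₁, hcuxx₁, hmt₁, hmx₁, hmxx₁, hcmt₁, hcmx₁, hcmxx₁,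
    hhjb₁, hfp₁, hm0₁, huT₁, hub₁, hmb₁, huxb₁, hfl₁⟩ := hsol₁
  obtain ⟨hut₂, hux₂, huxx₂, hcut₂, hcux₂, hcuxx₂, hmt₂, hmx₂, hmxx₂, hcmt₂, hcmx₂, hcmxx₂,
    hhjb₂, hfp₂, hm0₂, huT₂, hub₂, hmb₂, huxb₂, hfl₂⟩ := hsol₂
  have hT := hdata.hT
  have hL := hdata.hL
  have hcu₁ := continuous_uncurry_of_continuous_pdx hut₁ hux₁ hcux₁
  have hcu₂ := continuous_uncurry_of_continuous_pdx hut₂ hux₂ hcux₂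
  have hcm₁ := continuous_uncurry_of_continuous_pdx hmt₁ hmx₁ hcmx₁
  have hcm₂ := continuous_uncurry_of_continuous_pdx hmt₂ hmx₂ hcmx₂
  let W : ℝ → ℝ → ℝ := fun t x => Real.exp (-(r * t)) * ((u₁ t x - u₂ t x) * (m₁ t x - m₂ t x))
  let D : ℝ → ℝ → ℝ := fun t x => Real.exp (-(r * t)) *
    (-r * ((u₁ t x - u₂ t x) * (m₁ t x - m₂ t x))
      + (pdt u₁ t x - pdt u₂ t x) * (m₁ t x - m₂ t x)
      + (u₁ t x - u₂ t x) * (pdt m₁ t x - pdt m₂ t x))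
  have hD : Continuous (uncurry D) := by
    have hexp : Continuous fun p : ℝ × ℝ => Real.exp (-(r * p.1)) := by fun_prop
    exact hexp.mul (((continuous_const.mul ((hcu₁.sub hcu₂).mul (hcm₁.sub hcm₂))).add
      ((hcut₁.sub hcut₂).mul (hcm₁.sub hcm₂))).add ((hcu₁.sub hcu₂).mul (hcmt₁.sub hcmt₂)))
  have hW : ∀ t x, HasDerivAt (fun s => W s x) (D t x) t := by
    intro t x
    have hexp : HasDerivAt (fun s : ℝ => Real.exp (-(r * s))) (Real.exp (-(r * t)) * -(r * 1)) t :=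
      (((hasDerivAt_id t).const_mul r).neg).exp
    have hU := (hut₁ x t).hasDerivAt.sub (hut₂ x t).hasDerivAt
    have hM := (hmt₁ x t).hasDerivAt.sub (hmt₂ x t).hasDerivAt
    refine (hexp.mul (hU.mul hM)).congr_deriv ?_
    simp only [D, pdt, Pi.sub_apply, Pi.mul_apply]
    ring
  have hzero : ∫ t in (0:ℝ)..T, ∫ x in (0:ℝ)..L, D t x = 0 := by
    refine integral_integral_deriv_eq_zero (W := W) hL.le hD hW (fun x hx => ?_) fun x hx => ?_
    · simp [W, hm0₁ x hx, hm0₂ x hx]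
    · simp [W, huT₁ x hx, huT₂ x hx]
  refine neg_eq_zero.mp (Eq.trans ?_ hzero)
  rw [← intervalIntegral.integral_neg]
  refine integral_congr_Ioo_of_le hT.le fun t ht => ?_
  have htc : t ∈ Icc 0 T := Ioo_subset_Icc_self ht
  have slice : ∀ {g : ℝ → ℝ → ℝ}, Continuous (uncurry g) → Continuous (g t) :=
    fun hg => hg.comp (Continuous.prodMk_right t)
  have := slice hcu₁
  have := slice hcu₂
  have := slice hcm₁
  have := slice hcm₂
  have := slice hcux₁
  have := slice hcux₂
  have := slice hcmx₁
  have := slice hcmx₂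
  have := slice hcuxx₁
  have := slice hcuxx₂
  have := slice hcmxx₁
  have := slice hcmxx₂
  have hcG₁ : Continuous (mfgG L ε u₁ m₁ t) := by unfold mfgG; fun_prop
  have hcG₂ : Continuous (mfgG L ε u₂ m₂ t) := by unfold mfgG; fun_prop
  let Φ : ℝ → ℝ := fun x =>
    σ^2/2 * ((u₁ t x - u₂ t x) * (pdx m₁ t x - pdx m₂ t x)
      - (pdx u₁ t x - pdx u₂ t x) * (m₁ t x - m₂ t x))
    + (u₁ t x - u₂ t x) * (mfgG L ε u₁ m₁ t x * m₁ t x - mfgG L ε u₂ m₂ t x * m₂ t x)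
  let Φ' : ℝ → ℝ := fun x =>
    σ^2/2 * ((u₁ t x - u₂ t x) * (pdxx m₁ t x - pdxx m₂ t x)
      - (pdxx u₁ t x - pdxx u₂ t x) * (m₁ t x - m₂ t x))
    + (pdx u₁ t x - pdx u₂ t x) * (mfgG L ε u₁ m₁ t x * m₁ t x - mfgG L ε u₂ m₂ t x * m₂ t x)
    + (u₁ t x - u₂ t x) *
      ((-(1/2) * pdxx u₁ t x * m₁ t x + mfgG L ε u₁ m₁ t x * pdx m₁ t x)
        - (-(1/2) * pdxx u₂ t x * m₂ t x + mfgG L ε u₂ m₂ t x * pdx m₂ t x))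
  have hΦ : ∀ x, HasDerivAt Φ (Φ' x) x := by
    intro x
    have hU := (hux₁ t x).hasDerivAt.sub (hux₂ t x).hasDerivAt
    have hM := (hmx₁ t x).hasDerivAt.sub (hmx₂ t x).hasDerivAt
    have hUx := (huxx₁ t x).hasDerivAt.sub (huxx₂ t x).hasDerivAt
    have hMx := (hmxx₁ t x).hasDerivAt.sub (hmxx₂ t x).hasDerivAt
    have hK := (hasDerivAt_mfgG_mul (L := L) (ε := ε) (huxx₁ t) (hmx₁ t) x).sub
      (hasDerivAt_mfgG_mul (L := L) (ε := ε) (huxx₂ t) (hmx₂ t) x)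
    refine ((((hU.mul hMx).sub (hUx.mul hM)).const_mul (σ^2/2)).add (hU.mul hK)).congr_deriv ?_
    simp only [Φ', pdx, pdxx, Pi.sub_apply]
    ring
  have hΦ'c : Continuous Φ' := by
    simp only [Φ']
    fun_prop
  have hΦint : ∫ x in (0:ℝ)..L, Φ' x = 0 := by
    rw [integral_eq_sub_of_hasDerivAt (fun x _ => hΦ x) (hΦ'c.intervalIntegrable _ _)]
    have hΦL : Φ L = 0 := by
      simp only [Φ, huxb₁ t htc, huxb₂ t htc]
      linear_combination (u₁ t L - u₂ t L) * (hfl₁ t htc - hfl₂ t htc)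
    have hΦ0 : Φ 0 = 0 := by
      simp only [Φ, hub₁ t htc, hub₂ t htc, hmb₁ t htc, hmb₂ t htc]
      ring
    rw [hΦL, hΦ0, sub_zero]
  calc -(∫ x in (0:ℝ)..L, Real.exp (-(r * t)) *
      ((mfgH L ε u₁ m₁ t x - mfgH L ε u₂ m₂ t x) * (m₁ t x - m₂ t x)
        + (mfgG L ε u₁ m₁ t x * m₁ t x - mfgG L ε u₂ m₂ t x * m₂ t x)
          * (pdx u₁ t x - pdx u₂ t x)))
      = ∫ x in (0:ℝ)..L, (D t x - Real.exp (-(r * t)) * Φ' x) := by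
        rw [← intervalIntegral.integral_neg]
        refine integral_congr_Ioo_of_le hL.le fun x hx => ?_
        have h₁ := hfp₁ t ht x hx
        have h₂ := hfp₂ t ht x hx
        rw [(hasDerivAt_mfgG_mul (huxx₁ t) (hmx₁ t) x).deriv] at h₁
        rw [(hasDerivAt_mfgG_mul (huxx₂ t) (hmx₂ t) x).deriv] at h₂
        simp only [D, Φ']
        linear_combination Real.exp (-(r * t)) *
          (-(m₁ t x - m₂ t x) * (hhjb₁ t ht x hx - hhjb₂ t ht x hx)
            - (u₁ t x - u₂ t x) * (h₁ - h₂))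
    _ = ∫ x in (0:ℝ)..L, D t x := by
        rw [intervalIntegral.integral_sub ((slice hD).intervalIntegrable _ _)
          ((hΦ'c.intervalIntegrable _ _).const_mul _),
          intervalIntegral.integral_const_mul _ Φ', hΦint, mul_zero, sub_zero]
end
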